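/- arXiv:1809.10407 — 2 statements merged into one kernel-verified Lean document; each statement's English description precedes it below -/
import Mathlib

section
/- Let m be a square-free positive integer with m ≡ 2 (mod 4), let θ = m^(1/4) be the real positive fourth root of m, and let K = ℚ(i, θ). Then K is not monogenic: there is no α in the ring of integers O_K of K such that O_K = ℤ[α] (equivalently, no α ∈ O_K such that {1, α, α², …, α⁷} is an integral basis of K). -/
open NumberField

/-- The real positive fourth root of `m`, viewed as a complex number. -/
noncomputable def theta (m : ℕ) : ℂ := ((m : ℝ) ^ ((1 : ℝ) / 4) : ℝ)

/-- The octic field `K = ℚ(i, m^(1/4))` as a subfield of `ℂ`. -/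
noncomputable def Kfield (m : ℕ) : IntermediateField ℚ ℂ :=
  IntermediateField.adjoin ℚ {Complex.I, theta m}

section Coordinates

variable {K : Type*} [Field K]

/-- The `ℤ[i]`-combination, with coefficients `p j + q j * i`, of `1`, `φ = t² / (1 + i)`, `t` and
`(t + t * φ) / (1 + i)`. -/
def latticeElt (i t : K) (p q : Fin 4 → ℤ) : K :=
  (p 0 + q 0 * i) + (p 1 + q 1 * i) * ((1 - i) * t ^ 2 / 2) + (p 2 + q 2 * i) * t +
    (p 3 + q 3 * i) * ((1 - i) * t / 2 - i * t ^ 3 / 2)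

/-- The ring homomorphisms of `K` realise all eight substitutions `i ↦ ± i`, `t ↦ i ^ k * t`. -/
def HasConjugations (i t : K) : Prop :=
  ∀ k : ℕ, (∃ g : K →+* K, g i = i ∧ g t = i ^ k * t) ∧ ∃ g : K →+* K, g i = -i ∧ g t = i ^ k * t

lemma map_latticeElt (g : K →+* K) (i t : K) (p q : Fin 4 → ℤ) :
    g (latticeElt i t p q) = latticeElt (g i) (g t) p q := by
  simp [latticeElt, map_ofNat]

lemma isIntegral_of_sq_eq_neg_one {i : K} (hi : i ^ 2 = -1) : IsIntegral ℤ i :=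
  IsIntegral.of_pow (n := 2) (by norm_num) (by rw [hi]; exact isIntegral_one.neg)

lemma isIntegral_gaussian {i : K} (hi : i ^ 2 = -1) (a b : ℤ) : IsIntegral ℤ ((a : K) + b * i) :=
  (isIntegral_algebraMap (R := ℤ) (x := a)).add
    ((isIntegral_algebraMap (R := ℤ) (x := b)).mul (isIntegral_of_sq_eq_neg_one hi))

lemma gaussian_eq_one_add_mul {i : K} (hi : i ^ 2 = -1) {a b : ℤ} (h : Even (a + b)) :
    ∃ c d : ℤ, (a : K) + b * i = (1 + i) * (c + d * i) ∧ a = c - d ∧ b = c + d := by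
  obtain ⟨c, hc⟩ := h
  refine ⟨c, b - c, ?_, by omega, by omega⟩
  obtain rfl : a = 2 * c - b := by omega
  push_cast
  linear_combination (-(b : K) + c) * hi

variable [CharZero K]

lemma exists_int_of_isIntegral_ratCast {r : ℚ} (h : IsIntegral ℤ (r : K)) : ∃ z : ℤ, r = z := by
  have h1 : IsIntegral ℤ r := by
    rw [← isIntegral_algebraMap_iff (A := ℚ) (B := K) (algebraMap ℚ K).injective]
    simpa using h
  obtain ⟨z, hz⟩ := IsIntegrallyClosed.isIntegral_iff.1 h1
  exact ⟨z, by simpa using hz.symm⟩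

lemma one_add_ne_zero_of_sq_eq_neg_one {i : K} (hi : i ^ 2 = -1) : (1 + i : K) ≠ 0 := by
  intro h
  have : (2 : K) = 0 := by linear_combination (1 - i) * h + hi
  exact two_ne_zero this

lemma even_of_isIntegral_half {i t : K} (hi : i ^ 2 = -1) (H : HasConjugations i t) {a b : ℤ}
    (h : IsIntegral ℤ (((a : K) + b * i) / 2)) : Even a ∧ Even b := by
  obtain ⟨g, hg, -⟩ := (H 0).2
  have h1 := h.mul (map_isIntegral_int g h)
  have h2 : ((a : K) + b * i) / 2 * g (((a : K) + b * i) / 2) =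
      (((a ^ 2 + b ^ 2 : ℤ) / 4 : ℚ) : K) := by
    simp only [map_div₀, map_add, map_mul, map_intCast, hg, map_ofNat]
    push_cast
    linear_combination (-(b : K) ^ 2 / 4) * hi
  rw [h2] at h1
  obtain ⟨z, hz⟩ := exists_int_of_isIntegral_ratCast h1
  have h3 : a ^ 2 + b ^ 2 = 4 * z := by
    have : ((a ^ 2 + b ^ 2 : ℤ) : ℚ) = ((4 * z : ℤ) : ℚ) := by push_cast at hz ⊢; linarith
    exact_mod_cast this
  rcases Int.even_or_odd' a with ⟨x, rfl | rfl⟩ <;> rcases Int.even_or_odd' b with ⟨y, rfl | rfl⟩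
  · simp
  all_goals (exfalso; ring_nf at h3; omega)

/-- In the biquadratic subfield, `(f₀ + f₁ φ) / (1 + i)` is integral only when `1 + i` divides
`f₀` and `f₁`. -/
lemma even_of_isIntegral_div_one_add {i t : K} {n : ℕ} (hi : i ^ 2 = -1) (ht : t ^ 4 = 2 * n)
    (hn : Odd n) (H : HasConjugations i t) {a b c d : ℤ}
    (h : IsIntegral ℤ (((a : K) + b * i + (c + d * i) * ((1 - i) * t ^ 2 / 2)) / (1 + i))) :
    Even (a + b) ∧ Even (c + d) := by
  obtain ⟨g, hg, hgt⟩ := (H 1).1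
  have h1 := (h.mul (map_isIntegral_int g h)).mul (isIntegral_of_sq_eq_neg_one hi)
  have hne := one_add_ne_zero_of_sq_eq_neg_one hi
  have h2 : (((a : K) + b * i + (c + d * i) * ((1 - i) * t ^ 2 / 2)) / (1 + i)) *
      g (((a : K) + b * i + (c + d * i) * ((1 - i) * t ^ 2 / 2)) / (1 + i)) * i =
      (((a ^ 2 - b ^ 2 - 2 * n * c * d : ℤ) : K) +
        ((2 * a * b + n * (c ^ 2 - d ^ 2) : ℤ) : K) * i) / 2 := by
    have e : (i * t) ^ 2 = - t ^ 2 := by linear_combination t ^ 2 * hi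
    simp only [map_div₀, map_add, map_mul, map_sub, map_pow, map_one, map_intCast, hg, hgt,
      map_ofNat, pow_one, e]
    have hl : (1 + i) * (1 + i) = 2 * i := by linear_combination hi
    have h2i : i ≠ 0 := by rintro rfl; simp at hi
    rw [div_mul_div_comm, hl, div_mul_eq_mul_div, mul_div_mul_right _ _ h2i]
    congr 1
    have hφ : ((1 - i) * t ^ 2 / 2) ^ 2 = - i * n := by
      linear_combination (1 - i) ^ 2 / 4 * ht + n / 2 * hi
    push_cast
    linear_combination (-((c : K) + d * i) ^ 2) * hφ + (b ^ 2 + d ^ 2 * n * i + 2 * n * c * d) * hi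
  rw [h2] at h1
  obtain ⟨hA, hB⟩ := even_of_isIntegral_half hi H h1
  have hn' : ¬ Even (n : ℤ) := by simpa using hn
  constructor
  · simpa [parity_simps] using hA
  · simpa [parity_simps, hn'] using hB

lemma even_of_isIntegral_div_two {i t : K} {n : ℕ} (hi : i ^ 2 = -1) (ht : t ^ 4 = 2 * n)
    (hn : Odd n) (H : HasConjugations i t) {a b c d : ℤ}
    (h : IsIntegral ℤ (((a : K) + b * i + (c + d * i) * ((1 - i) * t ^ 2 / 2)) / 2)) :
    Even a ∧ Even b ∧ Even c ∧ Even d := by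
  have hne := one_add_ne_zero_of_sq_eq_neg_one hi
  have hI (a b : ℤ) : IsIntegral ℤ ((a : K) + b * i) := isIntegral_gaussian hi a b
  have h1 := h.mul (hI 1 (-1))
  have e1 : ((a : K) + b * i + (c + d * i) * ((1 - i) * t ^ 2 / 2)) / 2 *
      ((1 : ℤ) + (-1 : ℤ) * i) =
      ((a : K) + b * i + (c + d * i) * ((1 - i) * t ^ 2 / 2)) / (1 + i) := by
    rw [eq_div_iff hne]
    push_cast
    linear_combination (-((a : K) + b * i + (c + d * i) * ((1 - i) * t ^ 2 / 2)) / 2) * hi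
  rw [e1] at h1
  obtain ⟨hab, hcd⟩ := even_of_isIntegral_div_one_add hi ht hn H h1
  obtain ⟨a', b', hab', rfl, rfl⟩ := gaussian_eq_one_add_mul hi hab
  obtain ⟨c', d', hcd', rfl, rfl⟩ := gaussian_eq_one_add_mul hi hcd
  have h2 := h.mul (hI 0 1)
  have e2 : ((((a' - b' : ℤ) : K)) + ((a' + b' : ℤ) : K) * i +
        (((c' - d' : ℤ) : K) + ((c' + d' : ℤ) : K) * i) * ((1 - i) * t ^ 2 / 2)) / 2 *
      ((0 : ℤ) + (1 : ℤ) * i) =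
      ((-a' : ℤ) + (-b' : ℤ) * i + ((-c' : ℤ) + (-d' : ℤ) * i) * ((1 - i) * t ^ 2 / 2)) /
        (1 + i) := by
    rw [hab', hcd', eq_div_iff hne]
    push_cast
    linear_combination (((a' : K) + b' * i) * (1 + i / 2) +
      ((c' : K) + d' * i) * (1 + i / 2) * ((1 - i) * t ^ 2 / 2)) * hi
  rw [e2] at h2
  obtain ⟨h3, h4⟩ := even_of_isIntegral_div_one_add hi ht hn H h2
  simp only [parity_simps, even_neg] at h3 h4 ⊢
  exact ⟨h3, h3, h4, h4⟩

lemma isIntegral_latticeElt_basis {i t : K} {n : ℕ} (hi : i ^ 2 = -1) (ht : t ^ 4 = 2 * n)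
    (hn : Odd n) :
    IsIntegral ℤ ((1 - i) * t / 2 - i * t ^ 3 / 2) := by
  obtain ⟨k, rfl⟩ := hn
  have hφ : IsIntegral ℤ ((1 - i) * t ^ 2 / 2) := by
    refine IsIntegral.of_pow (n := 2) (by norm_num) ?_
    have e : ((1 - i) * t ^ 2 / 2) ^ 2 = (0 : ℤ) + (-(2 * k + 1) : ℤ) * i := by
      push_cast at ht ⊢
      linear_combination (1 - i) ^ 2 / 4 * ht + (2 * k + 1) / 2 * hi
    rw [e]
    exact isIntegral_gaussian hi _ _
  refine IsIntegral.of_pow (n := 2) (by norm_num) ?_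
  have e : ((1 - i) * t / 2 - i * t ^ 3 / 2) ^ 2 = ((1 - i) * t ^ 2 / 2) *
      (((-k : ℤ) + (-(k + 1) : ℤ) * i) +
        ((1 : ℤ) + (-1 : ℤ) * i) * ((1 - i) * t ^ 2 / 2)) := by
    push_cast at ht ⊢
    grind
  rw [e]
  exact hφ.mul ((isIntegral_gaussian hi _ _).add ((isIntegral_gaussian hi _ _).mul hφ))

/-- `1 + i` divides the coefficients of a lattice element as soon as the quotient of that element
by `1 + i` is integral. -/
lemma even_of_isIntegral_latticeElt_div {i t : K} {n : ℕ} (hi : i ^ 2 = -1) (ht : t ^ 4 = 2 * n)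
    (hn : Odd n) (H : HasConjugations i t) {p q : Fin 4 → ℤ}
    (h : IsIntegral ℤ (latticeElt i t p q / (1 + i))) : ∀ j, Even (p j + q j) := by
  obtain ⟨g, hg, hgt⟩ := (H 2).1
  obtain ⟨k, rfl⟩ := hn
  have h1 := (h.mul (map_isIntegral_int g h)).mul (isIntegral_of_sq_eq_neg_one hi)
  obtain ⟨p0, hp0⟩ : ∃ x, x = p 0 := ⟨_, rfl⟩
  obtain ⟨p1, hp1⟩ : ∃ x, x = p 1 := ⟨_, rfl⟩
  obtain ⟨p2, hp2⟩ : ∃ x, x = p 2 := ⟨_, rfl⟩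
  obtain ⟨p3, hp3⟩ : ∃ x, x = p 3 := ⟨_, rfl⟩
  obtain ⟨q0, hq0⟩ : ∃ x, x = q 0 := ⟨_, rfl⟩
  obtain ⟨q1, hq1⟩ : ∃ x, x = q 1 := ⟨_, rfl⟩
  obtain ⟨q2, hq2⟩ : ∃ x, x = q 2 := ⟨_, rfl⟩
  obtain ⟨q3, hq3⟩ : ∃ x, x = q 3 := ⟨_, rfl⟩
  have h2 : latticeElt i t p q / (1 + i) * g (latticeElt i t p q / (1 + i)) * i =
      (((p0 ^ 2 - q0 ^ 2 + (2 * k + 1) * (2 * p1 * q1) -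
          (2 * k + 1) * (2 * (p2 * q3 + q2 * p3) - (p3 ^ 2 - q3 ^ 2) + 2 * p3 * q3) : ℤ) : K) +
        ((2 * p0 * q0 - (2 * k + 1) * (p1 ^ 2 - q1 ^ 2) + (2 * k + 1) *
          (2 * (p2 * p3 - q2 * q3) + (p3 ^ 2 - q3 ^ 2) + 2 * p3 * q3) : ℤ) : K) * i +
        (((2 * (p0 * p1 - q0 * q1) - (p2 ^ 2 - q2 ^ 2 - 2 * p2 * q2) - 2 * (p2 * p3 - q2 * q3) +
          k * (p3 ^ 2 - q3 ^ 2) - (k + 1) * (2 * p3 * q3) : ℤ) : K) +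
        ((2 * (p0 * q1 + q0 * p1) - (p2 ^ 2 - q2 ^ 2 + 2 * p2 * q2) - 2 * (p2 * q3 + q2 * p3) +
          k * (2 * p3 * q3) + (k + 1) * (p3 ^ 2 - q3 ^ 2) : ℤ) : K) * i) *
          ((1 - i) * t ^ 2 / 2)) / 2 := by
    have hl : (1 + i) * (1 + i) = 2 * i := by linear_combination hi
    have h2i : i ≠ 0 := by rintro rfl; simp at hi
    rw [map_div₀, map_latticeElt, map_add, map_one, hg, hgt, hi, div_mul_div_comm, hl,
      div_mul_eq_mul_div, mul_div_mul_right _ _ h2i]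
    congr 1
    simp only [latticeElt, ← hp0, ← hp1, ← hp2, ← hp3, ← hq0, ← hq1, ← hq2, ← hq3]
    push_cast at ht ⊢
    grind
  rw [h2] at h1
  obtain ⟨hA, hB, hC, hD⟩ := even_of_isIntegral_div_two hi ht ⟨k, rfl⟩ H h1
  simp only [parity_simps, Int.not_even_one, even_two, ne_eq, OfNat.ofNat_ne_zero, not_false_eq_true,
    and_true, true_or, true_iff, iff_true, iff_false, not_true_eq_false, false_or] at hA hB hC hD
  rw [Fin.forall_fin_succ, Fin.forall_fin_succ, Fin.forall_fin_succ, Fin.forall_fin_one]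
  simp only [Fin.succ_zero_eq_one, Fin.succ_one_eq_two, Int.even_add, ← hp0, ← hp1, ← hp2, ← hq0,
    ← hq1, ← hq2]
  change _ ∧ _ ∧ _ ∧ (Even (p 3) ↔ Even (q 3))
  rw [← hp3, ← hq3]
  clear h h1 h2 hp0 hp1 hp2 hp3 hq0 hq1 hq2 hq3
  grind

lemma exists_latticeElt_of_isIntegral_div_pow {i t : K} {n : ℕ} (hi : i ^ 2 = -1)
    (ht : t ^ 4 = 2 * n) (hn : Odd n) (H : HasConjugations i t) (N : ℕ) {p q : Fin 4 → ℤ}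
    (h : IsIntegral ℤ (latticeElt i t p q / (1 + i) ^ N)) :
    ∃ p' q' : Fin 4 → ℤ, latticeElt i t p q / (1 + i) ^ N = latticeElt i t p' q' := by
  induction N generalizing p q with
  | zero => exact ⟨p, q, by simp⟩
  | succ N ih =>
    have hne := one_add_ne_zero_of_sq_eq_neg_one hi
    have hl : IsIntegral ℤ (1 + i) := isIntegral_one.add (isIntegral_of_sq_eq_neg_one hi)
    have h1 := h.mul (hl.pow N)
    have e1 : latticeElt i t p q / (1 + i) ^ (N + 1) * (1 + i) ^ N =
        latticeElt i t p q / (1 + i) := by field_simp; ring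
    rw [e1] at h1
    choose p' q' hpq _ _ using fun j => gaussian_eq_one_add_mul hi
      (even_of_isIntegral_latticeElt_div hi ht hn H h1 j)
    have e2 : latticeElt i t p q = (1 + i) * latticeElt i t p' q' := by
      simp only [latticeElt, hpq]
      ring
    have e3 : latticeElt i t p q / (1 + i) ^ (N + 1) = latticeElt i t p' q' / (1 + i) ^ N := by
      rw [e2]
      field_simp
      ring
    rw [e3] at h ⊢
    exact ih h

lemma Rat.exists_int_of_pow_four_mul {r : ℚ} {m j : ℕ} (hm : Squarefree m) (hj : j ≤ 3) {z : ℤ}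
    (h : r ^ 4 * m ^ j = z) : ∃ y : ℤ, r = y := by
  have h1 : r.num ^ 4 * (m : ℤ) ^ j = z * (r.den : ℤ) ^ 4 := by
    have hd : (r.den : ℚ) ≠ 0 := by exact_mod_cast r.den_nz
    have h2 : (r.num : ℚ) = r * r.den := by rw [Rat.mul_den_eq_num]
    have : (r.num : ℚ) ^ 4 * (m : ℚ) ^ j = z * (r.den : ℚ) ^ 4 := by
      rw [h2, ← h]
      ring
    exact_mod_cast this
  have h3 : r.den ^ 4 ∣ m ^ j := by
    have : IsCoprime ((r.den : ℤ) ^ 4) (r.num ^ 4) := by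
      refine IsCoprime.pow ?_
      rw [Int.isCoprime_iff_gcd_eq_one]
      simpa [Int.gcd] using r.reduced.symm
    have h4 := this.dvd_of_dvd_mul_left (Dvd.intro_left z h1.symm)
    exact_mod_cast h4
  have h5 : r.den = 1 := by
    by_contra hne
    obtain ⟨s, hs, hsd⟩ := Nat.exists_prime_and_dvd hne
    have h6 : s ^ 4 ∣ m ^ 3 := (pow_dvd_pow_of_dvd hsd 4).trans (h3.trans (pow_dvd_pow m hj))
    obtain ⟨c, rfl⟩ : s ∣ m := hs.dvd_of_dvd_pow ((dvd_pow_self s four_ne_zero).trans h6)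
    rw [mul_pow, pow_succ, Nat.mul_dvd_mul_iff_left (pow_pos hs.pos 3)] at h6
    obtain ⟨d, rfl⟩ := hs.dvd_of_dvd_pow h6
    exact hs.not_isUnit (hm s ⟨d, by ring⟩)
  exact ⟨r.num, (Rat.coe_int_num_of_den_eq_one h5).symm⟩

lemma exists_int_of_isIntegral_mul_pow {t : K} {m j : ℕ} (ht : t ^ 4 = m) (hm : Squarefree m)
    (hj : j ≤ 3) {r : ℚ} (h : IsIntegral ℤ ((r : K) * t ^ j)) : ∃ y : ℤ, r = y := by
  have h1 := h.pow 4
  have e : ((r : K) * t ^ j) ^ 4 = ((r ^ 4 * m ^ j : ℚ) : K) := by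
    push_cast
    rw [← ht]
    ring
  rw [e] at h1
  obtain ⟨z, hz⟩ := exists_int_of_isIntegral_ratCast h1
  exact Rat.exists_int_of_pow_four_mul hm hj hz

/-- The integral elements of `K` all lie in the lattice. -/
lemma exists_latticeElt_of_isIntegral {i t : K} {n : ℕ} (hi : i ^ 2 = -1) (ht : t ^ 4 = 2 * n)
    (hn : Odd n) (hm : Squarefree (2 * n)) (H : HasConjugations i t) {x y : Fin 4 → ℚ}
    (h : IsIntegral ℤ (∑ j, ((x j : K) + y j * i) * t ^ (j : ℕ))) :
    ∃ p q : Fin 4 → ℤ, ∑ j, ((x j : K) + y j * i) * t ^ (j : ℕ) = latticeElt i t p q := by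
  have hI := isIntegral_of_sq_eq_neg_one hi
  have hσ (k : ℕ) : IsIntegral ℤ (∑ j, ((x j : K) + y j * i) * (i ^ k * t) ^ (j : ℕ)) := by
    obtain ⟨g, hg, hgt⟩ := (H k).1
    simpa [hg, hgt] using map_isIntegral_int g h
  have hτ (k : ℕ) : IsIntegral ℤ (∑ j, ((x j : K) + y j * -i) * (i ^ k * t) ^ (j : ℕ)) := by
    obtain ⟨g, hg, hgt⟩ := (H k).2
    simpa [hg, hgt] using map_isIntegral_int g h
  have ht' : t ^ 4 = ((2 * n : ℕ) : K) := by exact_mod_cast ht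
  have hx (j : Fin 4) : ∃ z : ℤ, 8 * x j = z := by
    refine exists_int_of_isIntegral_mul_pow ht' hm (Nat.le_of_lt_succ j.2) ?_
    have h1 : IsIntegral ℤ (∑ k ∈ Finset.range 4, i ^ (3 * k * j) *
        ((∑ j, ((x j : K) + y j * i) * (i ^ k * t) ^ (j : ℕ)) +
          (∑ j, ((x j : K) + y j * -i) * (i ^ k * t) ^ (j : ℕ)))) :=
      IsIntegral.sum _ fun k _ => (hI.pow _).mul ((hσ k).add (hτ k))
    convert h1 using 1
    simp only [Finset.sum_range_succ, Finset.sum_range_zero, Fin.sum_univ_four]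
    push_cast
    fin_cases j <;> simp <;> grind
  have hy (j : Fin 4) : ∃ z : ℤ, 8 * y j = z := by
    refine exists_int_of_isIntegral_mul_pow ht' hm (Nat.le_of_lt_succ j.2) ?_
    have h1 : IsIntegral ℤ (∑ k ∈ Finset.range 4, i ^ (3 * k * j + 3) *
        ((∑ j, ((x j : K) + y j * i) * (i ^ k * t) ^ (j : ℕ)) -
          (∑ j, ((x j : K) + y j * -i) * (i ^ k * t) ^ (j : ℕ)))) :=
      IsIntegral.sum _ fun k _ => (hI.pow _).mul ((hσ k).sub (hτ k))
    convert h1 using 1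
    simp only [Finset.sum_range_succ, Finset.sum_range_zero, Fin.sum_univ_four]
    push_cast
    fin_cases j <;> simp <;> grind
  choose X hX using hx
  choose Y hY using hy
  have hX' (j : Fin 4) : (x j : K) = X j / 8 := by
    rw [eq_div_iff (by norm_num), mul_comm]
    exact_mod_cast congrArg (Rat.cast : ℚ → K) (hX j)
  have hY' (j : Fin 4) : (y j : K) = Y j / 8 := by
    rw [eq_div_iff (by norm_num), mul_comm]
    exact_mod_cast congrArg (Rat.cast : ℚ → K) (hY j)
  have e : ∑ j, ((x j : K) + y j * i) * t ^ (j : ℕ) =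
      latticeElt i t ![2 * X 0, 2 * (X 2 - Y 2), 2 * (X 1 - X 3 + Y 3), -4 * Y 3]
        ![2 * Y 0, 2 * (X 2 + Y 2), 2 * (Y 1 - X 3 - Y 3), 4 * X 3] / (1 + i) ^ 8 := by
    have h16 : (1 + i) ^ 8 = 16 := by grind
    rw [h16]
    simp only [Fin.sum_univ_four, latticeElt, hX', hY', Matrix.cons_val]
    push_cast
    simp
    grind
  rw [e] at h ⊢
  exact exists_latticeElt_of_isIntegral_div_pow hi ht hn H 8 h

/-- The norm of `2 * q + c * η + b * η² / 2 + a * η³ / 4`, where `η ^ 4 = -8 * n`. -/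
def quarticNorm (n q b c a : ℤ) : ℤ :=
  2 * (2 * (2 * q ^ 2 - n * b ^ 2 + 2 * n * a * c) ^ 2 +
    n * (4 * q * b - 2 * c ^ 2 + n * a ^ 2) ^ 2)

lemma prod_eq_quarticNorm {η i : K} {n : ℤ} (hi : i ^ 2 = -1) (hη : η ^ 4 = -8 * n)
    (q b c a : ℤ) :
    ∏ k ∈ Finset.range 4, i * (2 * q + c * (i ^ k * η) + b * (i ^ k * η) ^ 2 / 2 +
      a * (i ^ k * η) ^ 3 / 4) = (quarticNorm n q b c a : K) := by
  have h4 : i ^ 4 = 1 := by linear_combination (i ^ 2 - 1) * hi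
  have h1 : (2 * q + c * (i ^ 0 * η) + b * (i ^ 0 * η) ^ 2 / 2 + a * (i ^ 0 * η) ^ 3 / 4) *
      (2 * q + c * (i ^ 2 * η) + b * (i ^ 2 * η) ^ 2 / 2 + a * (i ^ 2 * η) ^ 3 / 4) =
      (4 * q ^ 2 - 2 * n * b ^ 2 + 4 * n * a * c) +
        (2 * q * b - c ^ 2 + n * a ^ 2 / 2) * η ^ 2 := by
    grind
  have h2 : (2 * q + c * (i ^ 1 * η) + b * (i ^ 1 * η) ^ 2 / 2 + a * (i ^ 1 * η) ^ 3 / 4) *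
      (2 * q + c * (i ^ 3 * η) + b * (i ^ 3 * η) ^ 2 / 2 + a * (i ^ 3 * η) ^ 3 / 4) =
      (4 * q ^ 2 - 2 * n * b ^ 2 + 4 * n * a * c) -
        (2 * q * b - c ^ 2 + n * a ^ 2 / 2) * η ^ 2 := by
    grind
  have h3 := congrArg₂ (· * ·) h1 h2
  rw [Finset.prod_mul_distrib, Finset.prod_const, Finset.card_range, h4, one_mul]
  simp only [Finset.prod_range_succ, Finset.prod_range_zero, quarticNorm]
  push_cast
  linear_combination h3 - (2 * q * b - c ^ 2 + n * a ^ 2 / 2) ^ 2 * hη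

lemma prod_sub_conj_three {i t : K} {n : ℕ} (hi : i ^ 2 = -1) (ht : t ^ 4 = 2 * n)
    (p q : Fin 4 → ℤ) :
    ∏ k ∈ Finset.range 4,
      (latticeElt i (i ^ k * t) p q - latticeElt (-i) (i ^ (k + 3) * t) p q) =
      (quarticNorm n (q 0) (p 1 + q 1) (p 2 + q 2 + q 3) (p 3 + q 3) : K) := by
  have hη : ((1 - i) * t) ^ 4 = -8 * (n : ℤ) := by
    push_cast
    grind
  rw [← prod_eq_quarticNorm hi hη]
  refine Finset.prod_congr rfl fun k _ => ?_
  have e : i ^ (k + 3) * t = -i * (i ^ k * t) := by grind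
  rw [e, show i ^ k * ((1 - i) * t) = (1 - i) * (i ^ k * t) by ring]
  generalize i ^ k * t = s
  simp only [latticeElt]
  push_cast
  grind

lemma prod_sub_conj_one {i t : K} {n : ℕ} (hi : i ^ 2 = -1) (ht : t ^ 4 = 2 * n)
    (p q : Fin 4 → ℤ) :
    ∏ k ∈ Finset.range 4,
      (latticeElt i (i ^ k * t) p q - latticeElt (-i) (i ^ (k + 1) * t) p q) =
      (quarticNorm n (q 0) (-(p 1 + q 1)) (q 2 - p 2 - p 3) (p 3 - q 3) : K) := by
  have hη : ((1 + i) * t) ^ 4 = -8 * (n : ℤ) := by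
    push_cast
    grind
  rw [← prod_eq_quarticNorm hi hη]
  refine Finset.prod_congr rfl fun k _ => ?_
  have e : i ^ (k + 1) * t = i * (i ^ k * t) := by ring
  rw [e, show i ^ k * ((1 + i) * t) = (1 + i) * (i ^ k * t) by ring]
  generalize i ^ k * t = s
  simp only [latticeElt]
  push_cast
  grind

lemma isIntegral_prod_sub_dvd {ι : Type*} (s : Finset ι) (g h : ι → K →+* K) {α : K}
    (hα : IsIntegral ℤ α) (P : Polynomial ℤ) {A B : ℤ}
    (hA : ∏ k ∈ s, (g k α - h k α) = A)
    (hB : ∏ k ∈ s, (g k (Polynomial.aeval α P) - h k (Polynomial.aeval α P)) = B) : A ∣ B := by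
  have key (k : ι) : ∃ γ : K, IsIntegral ℤ γ ∧
      g k (Polynomial.aeval α P) - h k (Polynomial.aeval α P) = (g k α - h k α) * γ := by
    let x : integralClosure ℤ K := ⟨g k α, map_isIntegral_int (g k) hα⟩
    let y : integralClosure ℤ K := ⟨h k α, map_isIntegral_int (h k) hα⟩
    obtain ⟨γ, hγ⟩ := Polynomial.sub_dvd_eval_sub x y (P.map (algebraMap ℤ _))
    refine ⟨γ, γ.2, ?_⟩
    have h1 (f : K →+* K) : f (Polynomial.aeval α P) = Polynomial.aeval (f α) P :=
      (Polynomial.aeval_algHom_apply f.toIntAlgHom α P).symm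
    have h2 (w : integralClosure ℤ K) :
        ((P.map (algebraMap ℤ _)).eval w : integralClosure ℤ K) =
          Polynomial.aeval (w : K) P := by
      rw [Polynomial.eval_map_algebraMap]
      exact (Polynomial.aeval_algHom_apply (integralClosure ℤ K).val w P).symm
    rw [h1, h1, ← h2 x, ← h2 y]
    exact congrArg Subtype.val hγ
  choose γ hγ hγ' using key
  have e : (B : K) = A * ∏ k ∈ s, γ k := by
    rw [← hA, ← hB, ← Finset.prod_mul_distrib]
    exact Finset.prod_congr rfl fun k _ => hγ' k
  rcases eq_or_ne A 0 with rfl | hA0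
  · have : (B : K) = 0 := by simpa using e
    simpa using this
  · have hA0' : (A : K) ≠ 0 := by exact_mod_cast hA0
    have e' : ∏ k ∈ s, γ k = ((B / A : ℚ) : K) := by
      push_cast
      rw [eq_div_iff hA0', e, mul_comm]
    have hi : IsIntegral ℤ (∏ k ∈ s, γ k) := IsIntegral.prod _ fun k _ => hγ k
    rw [e'] at hi
    obtain ⟨z, hz⟩ := exists_int_of_isIntegral_ratCast hi
    refine ⟨z, ?_⟩
    rw [div_eq_iff (by exact_mod_cast hA0), mul_comm] at hz
    exact_mod_cast hz


lemma odd_and_even_of_quarticNorm_dvd {n : ℕ} (hn : Odd n) {q b c a : ℤ}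
    (h16 : quarticNorm n q b c a ∣ 16) (h2n : quarticNorm n q b c a ∣ 2 * n ^ 3) :
    Odd a ∧ Even (q + c) := by
  rw [quarticNorm] at h16 h2n
  set X := 2 * q ^ 2 - n * b ^ 2 + 2 * n * a * c with hX
  set Y := 4 * q * b - 2 * c ^ 2 + n * a ^ 2 with hY
  have hn0 : (0 : ℤ) < n := by exact_mod_cast hn.pos
  have h8 : 2 * X ^ 2 + n * Y ^ 2 ∣ 2 ^ 3 :=
    (mul_dvd_mul_iff_left two_ne_zero).1 (by simpa using h16)
  have hn3 : 2 * X ^ 2 + n * Y ^ 2 ∣ (n : ℤ) ^ 3 := (mul_dvd_mul_iff_left two_ne_zero).1 h2n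
  have hco : IsCoprime ((2 : ℤ) ^ 3) ((n : ℤ) ^ 3) := by
    refine IsCoprime.pow ?_
    exact_mod_cast Nat.isCoprime_iff_coprime.2 (Nat.coprime_two_left.2 hn)
  have hu : 2 * X ^ 2 + n * Y ^ 2 = 1 := by
    rcases Int.isUnit_iff.1 (hco.isUnit_of_dvd' h8 hn3) with h | h
    · exact h
    · nlinarith [sq_nonneg X, mul_nonneg hn0.le (sq_nonneg Y)]
  have hX0 : X = 0 := by
    by_contra hne
    nlinarith [Int.one_le_abs hne, sq_abs X, mul_nonneg hn0.le (sq_nonneg Y)]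
  rw [hX0] at hu hX
  have hn1 : (n : ℤ) = 1 := by
    refine Int.eq_one_of_dvd_one hn0.le ⟨Y ^ 2, by linarith⟩
  rw [hn1] at hu hX hY
  have hYo : Odd Y := by
    have : Odd (Y ^ 2) := ⟨0, by linarith⟩
    simpa [parity_simps] using this
  have ha : Odd a := by
    rw [hY] at hYo
    by_contra h
    rw [Int.not_odd_iff_even] at h
    refine Int.not_even_iff_odd.2 hYo ?_
    have h4 : Even (4 : ℤ) := ⟨2, rfl⟩
    simp [parity_simps, h, h4]
  refine ⟨ha, ?_⟩
  have hb : Even b := by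
    have : Even (b ^ 2) := ⟨q ^ 2 + a * c, by linarith⟩
    simpa [parity_simps] using this
  obtain ⟨d, rfl⟩ := hb
  have hqc : Even (q ^ 2 + a * c) := ⟨d ^ 2, by linarith⟩
  have ha' : ¬ Even a := Int.not_even_iff_odd.2 ha
  simpa [parity_simps, ha'] using hqc

/-- If every `z : K` lies in the `ℚ`-span of `t ^ j` and `i * t ^ j`, then no integral element
generates all integral elements over `ℤ`. -/
theorem exists_isIntegral_ne_aeval {i t : K} {n : ℕ} (hi : i ^ 2 = -1) (ht : t ^ 4 = 2 * n)
    (hn : Odd n) (hm : Squarefree (2 * n)) (H : HasConjugations i t)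
    (hspan : ∀ z : K, ∃ x y : Fin 4 → ℚ, z = ∑ j, ((x j : K) + y j * i) * t ^ (j : ℕ))
    {α : K} (hα : IsIntegral ℤ α) :
    ∃ β : K, IsIntegral ℤ β ∧ ∀ P : Polynomial ℤ, Polynomial.aeval α P ≠ β := by
  by_contra! hgen
  obtain ⟨x, y, hxy⟩ := hspan α
  obtain ⟨p, q, hpq⟩ := exists_latticeElt_of_isIntegral hi ht hn hm H (hxy ▸ hα)
  rw [← hxy] at hpq
  choose g hg hgt using fun k => (H k).1
  choose h hh hht using fun k => (H k).2
  have hg' (k : ℕ) (p q : Fin 4 → ℤ) :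
      g k (latticeElt i t p q) = latticeElt i (i ^ k * t) p q := by
    rw [map_latticeElt, hg, hgt]
  have hh' (k : ℕ) (p q : Fin 4 → ℤ) :
      h k (latticeElt i t p q) = latticeElt (-i) (i ^ k * t) p q := by
    rw [map_latticeElt, hh, hht]
  have h3 (p' q' : Fin 4 → ℤ) (hβ : IsIntegral ℤ (latticeElt i t p' q')) :
      quarticNorm n (q 0) (p 1 + q 1) (p 2 + q 2 + q 3) (p 3 + q 3) ∣
        quarticNorm n (q' 0) (p' 1 + q' 1) (p' 2 + q' 2 + q' 3) (p' 3 + q' 3) := by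
    obtain ⟨P, hP⟩ := hgen _ hβ
    refine isIntegral_prod_sub_dvd (Finset.range 4) g (fun k => h (k + 3)) hα P ?_ ?_
    · simp only [hpq, hg', hh', prod_sub_conj_three hi ht]
    · simp only [hP, hg', hh', prod_sub_conj_three hi ht]
  have h1 (p' q' : Fin 4 → ℤ) (hβ : IsIntegral ℤ (latticeElt i t p' q')) :
      quarticNorm n (q 0) (-(p 1 + q 1)) (q 2 - p 2 - p 3) (p 3 - q 3) ∣
        quarticNorm n (q' 0) (-(p' 1 + q' 1)) (q' 2 - p' 2 - p' 3) (p' 3 - q' 3) := by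
    obtain ⟨P, hP⟩ := hgen _ hβ
    refine isIntegral_prod_sub_dvd (Finset.range 4) g (fun k => h (k + 1)) hα P ?_ ?_
    · simp only [hpq, hg', hh', prod_sub_conj_one hi ht]
    · simp only [hP, hg', hh', prod_sub_conj_one hi ht]
  have hI := isIntegral_of_sq_eq_neg_one hi
  have hψ := isIntegral_latticeElt_basis hi ht hn
  have hβ₀ : IsIntegral ℤ (latticeElt i t 0 ![1, 0, 0, 0]) := by
    convert hI using 1
    simp [latticeElt]
  have hβ₁ : IsIntegral ℤ (latticeElt i t ![0, 0, 0, 1] 0) := by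
    convert hψ using 1
    simp [latticeElt]
  have hβ₂ : IsIntegral ℤ (latticeElt i t 0 ![0, 0, 0, 1]) := by
    have e : latticeElt i t 0 ![0, 0, 0, 1] = i * ((1 - i) * t / 2 - i * t ^ 3 / 2) := by
      simp [latticeElt]
    exact e ▸ hI.mul hψ
  have d₁ := h3 _ _ hβ₁
  have d₂ := h1 _ _ hβ₂
  have e₁ : quarticNorm n 0 0 0 1 = 2 * n ^ 3 := by
    rw [quarticNorm]
    ring
  have e₂ : quarticNorm n 0 0 0 (-1) = 2 * n ^ 3 := by
    rw [quarticNorm]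
    ring
  obtain ⟨ha, hc⟩ := odd_and_even_of_quarticNorm_dvd hn
    (by simpa [quarticNorm] using h3 _ _ hβ₀) (by simpa [e₁] using d₁)
  obtain ⟨-, hc'⟩ := odd_and_even_of_quarticNorm_dvd hn
    (by simpa [quarticNorm] using h1 _ _ hβ₀) (by simpa [e₂] using d₂)
  grind

end Coordinates

lemma theta_pow_four (m : ℕ) : theta m ^ 4 = m := by
  rw [theta, ← Complex.ofReal_pow, ← Real.rpow_natCast, ← Real.rpow_mul m.cast_nonneg]
  norm_num

lemma I_mem_Kfield (m : ℕ) : Complex.I ∈ Kfield m :=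
  IntermediateField.subset_adjoin _ _ (by simp)

lemma theta_mem_Kfield (m : ℕ) : theta m ∈ Kfield m :=
  IntermediateField.subset_adjoin _ _ (by simp)

open Polynomial in
lemma minpoly_theta {n : ℕ} (hn : Odd n) :
    minpoly ℚ (theta (2 * n)) = X ^ 4 - C ((2 * n : ℕ) : ℚ) := by
  have hmonic : (X ^ 4 - C ((2 * n : ℕ) : ℤ)).Monic := monic_X_pow_sub_C _ four_ne_zero
  have hdeg : (X ^ 4 - C ((2 * n : ℕ) : ℤ)).natDegree = 4 := natDegree_X_pow_sub_C
  have heis : (X ^ 4 - C ((2 * n : ℕ) : ℤ)).IsEisensteinAt (Ideal.span {2}) := by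
    refine ⟨?_, fun {k} hk => ?_, ?_⟩
    · rw [hmonic.leadingCoeff, Ideal.mem_span_singleton]
      norm_num
    · rw [hdeg] at hk
      rw [Ideal.mem_span_singleton, coeff_sub, coeff_X_pow, if_neg hk.ne, coeff_C]
      split_ifs <;> simp
    · rw [Ideal.span_singleton_pow, Ideal.mem_span_singleton]
      obtain ⟨k, rfl⟩ := hn
      simp
      omega
  have hprime : (Ideal.span {(2 : ℤ)}).IsPrime :=
    (Ideal.span_singleton_prime two_ne_zero).2 Int.prime_two
  have hirr : Irreducible (X ^ 4 - C ((2 * n : ℕ) : ℚ)) := by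
    have h := (hmonic.irreducible_iff_irreducible_map_fraction_map (K := ℚ)).1
      (heis.irreducible hprime hmonic.isPrimitive (by rw [hdeg]; norm_num))
    rwa [Polynomial.map_sub, Polynomial.map_pow, map_X, map_C, eq_intCast, Int.cast_natCast] at h
  refine (minpoly.eq_of_irreducible_of_monic hirr ?_ (monic_X_pow_sub_C _ four_ne_zero)).symm
  simp [theta_pow_four]

lemma isIntegral_of_mem_generators {m : ℕ} {s : ℂ} (hs : s ∈ ({Complex.I, theta m} : Set ℂ)) :
    IsIntegral ℚ s := by
  rcases hs with rfl | rfl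
  · exact (Complex.isIntegral_int_I).tower_top
  · refine IsIntegral.of_pow four_pos ?_
    rw [theta_pow_four]
    exact isIntegral_algebraMap (R := ℚ) (x := (m : ℚ))

lemma exists_coordinates_of_mem_Kfield {m : ℕ} {z : ℂ} (hz : z ∈ Kfield m) :
    ∃ x y : Fin 4 → ℚ, z = ∑ j, ((x j : ℂ) + y j * Complex.I) * theta m ^ (j : ℕ) := by
  have hz' : z ∈ Algebra.adjoin ℚ {Complex.I, theta m} := by
    rw [← IntermediateField.adjoin_toSubalgebra_of_isAlgebraic fun s hs =>
      (isIntegral_of_mem_generators hs).isAlgebraic]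
    exact hz
  rw [← Subalgebra.mem_toSubmodule, Algebra.adjoin_eq_span] at hz'
  have ht := theta_pow_four m
  clear hz
  induction hz' using Submodule.span_induction with
  | mem z hz =>
    induction hz using Submonoid.closure_induction_left with
    | one => exact ⟨![1, 0, 0, 0], 0, by simp [Fin.sum_univ_four]⟩
    | mul_left s hs z _ ih =>
      obtain ⟨x, y, rfl⟩ := ih
      rcases hs with rfl | rfl
      · refine ⟨-y, x, ?_⟩
        simp only [Fin.sum_univ_four, Pi.neg_apply]
        push_cast
        grind [Complex.I_sq]
      · refine ⟨![m * x 3, x 0, x 1, x 2], ![m * y 3, y 0, y 1, y 2], ?_⟩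
        simp only [Fin.sum_univ_four, Matrix.cons_val]
        push_cast
        simp
        grind
  | zero => exact ⟨0, 0, by simp⟩
  | add z w _ _ hz hw =>
    obtain ⟨x, y, rfl⟩ := hz
    obtain ⟨u, v, rfl⟩ := hw
    refine ⟨x + u, y + v, ?_⟩
    simp only [Fin.sum_univ_four, Pi.add_apply]
    push_cast
    ring
  | smul r z _ hz =>
    obtain ⟨x, y, rfl⟩ := hz
    refine ⟨r • x, r • y, ?_⟩
    simp only [Fin.sum_univ_four, Pi.smul_apply, Algebra.smul_def, eq_ratCast]
    push_cast
    ring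

lemma exists_coordinates {m : ℕ} (z : Kfield m) :
    ∃ x y : Fin 4 → ℚ, z = ∑ j, ((x j : Kfield m) + y j * ⟨Complex.I, I_mem_Kfield m⟩) *
      ⟨theta m, theta_mem_Kfield m⟩ ^ (j : ℕ) := by
  obtain ⟨x, y, h⟩ := exists_coordinates_of_mem_Kfield z.2
  refine ⟨x, y, Subtype.ext ?_⟩
  rw [h]
  push_cast
  rfl

/-- A homomorphism from `K` to `ℂ` that sends the generators into `K` is an endomorphism
of `K`. -/
lemma exists_ringHom_coe_eq {m : ℕ} (σ : Kfield m →+* ℂ)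
    (hi : σ ⟨Complex.I, I_mem_Kfield m⟩ ∈ Kfield m)
    (ht : σ ⟨theta m, theta_mem_Kfield m⟩ ∈ Kfield m) :
    ∃ g : Kfield m →+* Kfield m, ∀ z, (g z : ℂ) = σ z := by
  refine ⟨σ.codRestrict (Kfield m) fun z => ?_, fun z => rfl⟩
  obtain ⟨x, y, rfl⟩ := exists_coordinates z
  simp only [map_sum, map_mul, map_add, map_ratCast, map_pow]
  exact sum_mem fun j _ => mul_mem (add_mem (SubfieldClass.ratCast_mem _ _)
    (mul_mem (SubfieldClass.ratCast_mem _ _) hi)) (pow_mem ht _)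

lemma hasConjugations_Kfield {n : ℕ} (hn : Odd n) :
    HasConjugations (⟨Complex.I, I_mem_Kfield (2 * n)⟩ : Kfield (2 * n))
      ⟨theta (2 * n), theta_mem_Kfield (2 * n)⟩ := by
  intro k
  have hI := I_mem_Kfield (2 * n)
  have hθ := theta_mem_Kfield (2 * n)
  obtain ⟨c, hc⟩ := exists_ringHom_coe_eq ((starRingEnd ℂ).comp (Kfield (2 * n)).val.toRingHom)
    (by simpa using hI) (by simpa [theta] using hθ)
  have hcI : c ⟨Complex.I, hI⟩ = -⟨Complex.I, hI⟩ := Subtype.ext (by simp [hc])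
  have hcθ : c ⟨theta (2 * n), hθ⟩ = ⟨theta (2 * n), hθ⟩ := Subtype.ext (by simp [hc, theta])
  obtain ⟨φ, hφ⟩ : ∃ φ : Kfield (2 * n) →ₐ[ℚ] ℂ,
      φ ⟨theta (2 * n), hθ⟩ = Complex.I ^ k * theta (2 * n) := by
    refine IntermediateField.exists_algHom_adjoin_of_splits_of_aeval
      (fun s hs => ⟨isIntegral_of_mem_generators hs, IsAlgClosed.splits _⟩) hθ ?_
    rw [minpoly_theta hn]
    have h4 : (Complex.I ^ k) ^ 4 = 1 := by rw [← pow_mul, mul_comm, pow_mul, Complex.I_pow_four,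
      one_pow]
    simp [mul_pow, h4, theta_pow_four]
  have hφI : φ ⟨Complex.I, hI⟩ = Complex.I ∨ φ ⟨Complex.I, hI⟩ = -Complex.I := by
    rw [← sq_eq_sq_iff_eq_or_eq_neg, ← map_pow, Complex.I_sq]
    have : (⟨Complex.I, hI⟩ : Kfield (2 * n)) ^ 2 = -1 := Subtype.ext (by simp)
    simp [this]
  obtain ⟨g, hg⟩ := exists_ringHom_coe_eq φ.toRingHom
    (by rcases hφI with h | h <;> simp [h, hI]) (by simpa [hφ] using mul_mem (pow_mem hI k) hθ)
  have hgθ : g ⟨theta (2 * n), hθ⟩ = ⟨Complex.I, hI⟩ ^ k * ⟨theta (2 * n), hθ⟩ :=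
    Subtype.ext (by simp [hg, hφ])
  rcases hφI with h | h
  · have hgI : g ⟨Complex.I, hI⟩ = ⟨Complex.I, hI⟩ := Subtype.ext (by simp [hg, h])
    exact ⟨⟨g, hgI, hgθ⟩, g.comp c, by simp [hcI, hgI], by simp [hcθ, hgθ]⟩
  · have hgI : g ⟨Complex.I, hI⟩ = -⟨Complex.I, hI⟩ := Subtype.ext (by simp [hg, h])
    exact ⟨⟨g.comp c, by simp [hcI, hgI], by simp [hcθ, hgθ]⟩, g, hgI, hgθ⟩

/-- For squarefree positive `m ≡ 2 (mod 4)`, the field `ℚ(i, m^(1/4))` is not monogenic. -/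
theorem stmt_0 (m : ℕ) (hm : Squarefree m) (hpos : 0 < m) (h2 : m % 4 = 2) :
    ¬ ∃ α : 𝓞 (Kfield m), Algebra.adjoin ℤ ({α} : Set (𝓞 (Kfield m))) = ⊤ := by
  rintro ⟨α, hα⟩
  obtain ⟨n, hn, rfl⟩ : ∃ n, Odd n ∧ m = 2 * n := ⟨m / 2, ⟨m / 4, by omega⟩, by omega⟩
  have ht : (⟨theta (2 * n), theta_mem_Kfield (2 * n)⟩ : Kfield (2 * n)) ^ 4 = 2 * n :=
    Subtype.ext ((theta_pow_four (2 * n)).trans (by push_cast; rfl))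
  obtain ⟨β, hβ, hne⟩ := exists_isIntegral_ne_aeval (Subtype.ext (by simp)) ht hn hm
    (hasConjugations_Kfield hn) exists_coordinates (RingOfIntegers.isIntegral_coe α)
  obtain ⟨b, rfl⟩ : ∃ b : 𝓞 (Kfield (2 * n)), (b : Kfield (2 * n)) = β := ⟨⟨β, hβ⟩, rfl⟩
  have hmem : b ∈ Algebra.adjoin ℤ {α} := hα ▸ Algebra.mem_top
  rw [Algebra.adjoin_singleton_eq_range_aeval] at hmem
  obtain ⟨P, hP : Polynomial.aeval α P = b⟩ := hmem
  exact hne P (by rw [Polynomial.aeval_algebraMap_apply, hP])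
end

section
/- Let m be a square-free positive integer with m ≡ 3 (mod 4), let θ = m^(1/4) be the real positive fourth root of m, and let K = ℚ(i, θ). Then the discriminant of the number field K equals 2^16 · m^6. -/
open NumberField

open Polynomial in
lemma irreducible_X_pow_four_sub {m : ℕ} (hm : Squarefree m) (h1 : m ≠ 1) :
    Irreducible (X ^ 4 - C (m : ℚ)) := by
  obtain ⟨p, hp, hpm⟩ := Nat.exists_prime_and_dvd h1
  have hmon : (X ^ 4 - C (m : ℤ)).Monic := monic_X_pow_sub_C _ (by norm_num)
  have hdeg : (X ^ 4 - C (m : ℤ)).natDegree = 4 := natDegree_X_pow_sub_C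
  have hirr : Irreducible (X ^ 4 - C (m : ℤ)) := by
    refine irreducible_of_eisenstein_criterion (P := Ideal.span {(p : ℤ)}) ?_ ?_ ?_ ?_ ?_
      hmon.isPrimitive
    · rw [Ideal.span_singleton_prime (by exact_mod_cast hp.ne_zero)]
      exact Nat.prime_iff_prime_int.mp hp
    · rw [hmon.leadingCoeff, Ideal.mem_span_singleton]
      intro h
      exact hp.one_lt.ne' (by exact_mod_cast Int.eq_one_of_dvd_one (by positivity) h)
    · intro n hn
      rw [degree_eq_natDegree hmon.ne_zero, hdeg] at hn
      have hn4 : n < 4 := by exact_mod_cast hn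
      rw [coeff_sub, coeff_X_pow, if_neg hn4.ne, coeff_C, Ideal.mem_span_singleton]
      split_ifs
      · simpa using Int.natCast_dvd_natCast.mpr hpm
      · simp
    · rw [degree_eq_natDegree hmon.ne_zero, hdeg]
      norm_num
    · rw [Ideal.span_singleton_pow, Ideal.mem_span_singleton]
      intro h
      have h' : ((p ^ 2 : ℕ) : ℤ) ∣ (m : ℕ) := by simpa using h
      exact hp.not_isUnit (hm p (by rw [← sq]; exact Int.natCast_dvd_natCast.mp h'))
  have := 
    (Polynomial.IsPrimitive.Int.irreducible_iff_irreducible_map_cast hmon.isPrimitive).mp hirr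
  simpa using this

/-- The powers of `θ` below the fourth are linearly independent over `ℚ`. -/
lemma coeff_eq_zero_of_theta {m : ℕ} (hm : Squarefree m) (h1 : m ≠ 1) (a : Fin 4 → ℚ)
    (h : ∑ k, (a k : ℂ) * theta m ^ (k : ℕ) = 0) : a = 0 := by
  have hmin : minpoly ℚ (theta m) = Polynomial.X ^ 4 - Polynomial.C (m : ℚ) :=
    (minpoly.eq_of_irreducible_of_monic (irreducible_X_pow_four_sub hm h1)
      (by simp [theta_pow_four]) (Polynomial.monic_X_pow_sub_C _ (by norm_num))).symm
  have hdeg : (minpoly ℚ (theta m)).natDegree = 4 := by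
    rw [hmin, Polynomial.natDegree_X_pow_sub_C]
  have hli := linearIndependent_pow (K := ℚ) (theta m)
  rw [hdeg, Fintype.linearIndependent_iff] at hli
  funext k
  exact hli a (by simpa [Rat.smul_def] using h) k

lemma coeff_eq_zero_of_I_theta {m : ℕ} (hm : Squarefree m) (h1 : m ≠ 1) (a : Fin 2 × Fin 4 → ℚ)
    (h : ∑ p, (a p : ℂ) * (Complex.I ^ (p.1 : ℕ) * theta m ^ (p.2 : ℕ)) = 0) : a = 0 := by
  have key (b : Fin 4 → ℚ) : ∑ k, (b k : ℂ) * theta m ^ (k : ℕ) =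
      ((∑ k, (b k : ℝ) * ((m : ℝ) ^ ((1 : ℝ) / 4)) ^ (k : ℕ) : ℝ) : ℂ) := by
    simp [theta]
  have h' : (∑ k, (a (0, k) : ℂ) * theta m ^ (k : ℕ)) +
      (∑ k, (a (1, k) : ℂ) * theta m ^ (k : ℕ)) * Complex.I = 0 := by
    rw [Fintype.sum_prod_type, Fin.sum_univ_two] at h
    rw [← h, Finset.sum_mul]
    congr 1 <;> exact Finset.sum_congr rfl fun k _ => by simp; try ring
  have h0 : ∑ k, (a (0, k) : ℂ) * theta m ^ (k : ℕ) = 0 := by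
    rw [key, key] at h'
    have := congrArg Complex.re h'
    rw [key]
    simpa only [Complex.add_re, Complex.ofReal_re, Complex.re_ofReal_mul, Complex.I_re, mul_zero,
      add_zero, Complex.zero_re, Complex.ofReal_eq_zero] using this
  have h0' : ∑ k, (a (1, k) : ℂ) * theta m ^ (k : ℕ) = 0 := by
    rw [h0, zero_add] at h'
    exact (mul_eq_zero.mp h').resolve_right Complex.I_ne_zero
  have e0 := coeff_eq_zero_of_theta hm h1 _ h0
  have e1 := coeff_eq_zero_of_theta hm h1 _ h0'
  funext ⟨j, k⟩
  fin_cases j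
  · exact congrFun e0 k
  · exact congrFun e1 k

lemma Rat.isInt_of_pow_four_mul {m : ℕ} (hm : Squarefree m) {k : ℕ} (hk : k < 4) {r : ℚ}
    (h : IsIntegral ℤ (r ^ 4 * (m : ℚ) ^ k)) : ∃ z : ℤ, r = z := by
  obtain ⟨z, hz⟩ := IsIntegrallyClosed.isIntegral_iff.mp h
  have hd : (r.den : ℚ) ≠ 0 := by exact_mod_cast r.den_nz
  have hz1 : (z : ℚ) * (r.den : ℚ) ^ 4 = (r.num : ℚ) ^ 4 * (m : ℚ) ^ k := by
    rw [eq_intCast] at hz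
    rw [hz]
    nth_rewrite 1 [← Rat.num_div_den r]
    field_simp
  have hz2 : z * (r.den : ℤ) ^ 4 = r.num ^ 4 * (m : ℤ) ^ k := by exact_mod_cast hz1
  have hcop : IsCoprime ((r.den : ℤ) ^ 4) (r.num ^ 4) := by
    refine (IsCoprime.pow ?_).symm
    rw [Int.isCoprime_iff_nat_coprime]
    simpa using r.reduced
  have hdvd : (r.den : ℤ) ^ 4 ∣ (m : ℤ) ^ k :=
    hcop.dvd_of_dvd_mul_left ⟨z, by rw [← hz2]; ring⟩
  have hdvd3 : r.den ^ 4 ∣ m ^ 3 := by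
    have : r.den ^ 4 ∣ m ^ k := by exact_mod_cast hdvd
    exact this.trans (pow_dvd_pow m (by omega))
  have hden : r.den = 1 := by
    by_contra hne
    obtain ⟨q, hq, hqd⟩ := Nat.exists_prime_and_dvd hne
    have h4 : q ^ 4 ∣ m ^ 3 := (pow_dvd_pow_of_dvd hqd 4).trans hdvd3
    obtain ⟨c, rfl⟩ : q ∣ m :=
      hq.dvd_of_dvd_pow ((dvd_pow_self q (by norm_num)).trans h4)
    have h5 : q ∣ c ^ 3 := by
      rw [mul_pow, pow_succ q 3] at h4
      exact Nat.dvd_of_mul_dvd_mul_left (pow_pos hq.pos 3) h4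
    exact hq.not_isUnit (hm q (mul_dvd_mul_left q (hq.dvd_of_dvd_pow h5)))
  exact ⟨r.num, ((Rat.den_eq_one_iff r).mp hden).symm⟩

lemma IsIntegral.of_eq {R A : Type*} [CommRing R] [Ring A] [Algebra R A] {x y : A}
    (h : IsIntegral R x) (e : y = x) : IsIntegral R y :=
  e ▸ h

lemma Complex.isIntegral_I : IsIntegral ℤ Complex.I :=
  IsIntegral.of_pow (n := 2) (by norm_num) (isIntegral_one.neg.of_eq Complex.I_sq)

lemma isIntegral_complex_ratCast_iff {r : ℚ} : IsIntegral ℤ (r : ℂ) ↔ IsIntegral ℤ r :=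
  isIntegral_algebraMap_iff (A := ℚ) (B := ℂ) (algebraMap ℚ ℂ).injective

lemma isIntegral_intCast_complex (a : ℤ) : IsIntegral ℤ (a : ℂ) :=
  isIntegral_algebraMap (R := ℤ) (A := ℂ) (x := a)

lemma sq_mul_two_eq {p : ℂ} (hp : p * (1 + Complex.I) = 1) : p ^ 2 * 2 = -Complex.I := by
  linear_combination (-Complex.I * (p * (1 + Complex.I) + 1)) * hp +
    p ^ 2 * (Complex.I + 2) * Complex.I_sq

lemma two_dvd_of_isIntegral_sq_mul {p : ℂ} (hp : p * (1 + Complex.I) = 1) {w : ℤ}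
    (h : IsIntegral ℤ ((w : ℂ) ^ 2 * p)) : (2 : ℤ) ∣ w := by
  have h1 : IsIntegral ℤ (((w : ℚ) ^ 4 / 2 : ℚ) : ℂ) := by
    refine ((h.pow 2).mul Complex.isIntegral_I).of_eq ?_
    push_cast
    linear_combination (-(w : ℂ) ^ 4 / 2 * Complex.I) * sq_mul_two_eq hp +
      (w : ℂ) ^ 4 / 2 * Complex.I_sq
  obtain ⟨z, hz⟩ := IsIntegrallyClosed.isIntegral_iff.mp (isIntegral_complex_ratCast_iff.mp h1)
  have h2 : w ^ 4 = 2 * z := by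
    rw [eq_intCast] at hz
    have : (w : ℚ) ^ 4 = 2 * z := by rw [hz]; ring
    exact_mod_cast this
  exact Int.prime_two.dvd_of_dvd_pow ⟨z, h2⟩

/-- The generator `(1 + i t²) / 2` of the ring of integers of `ℚ(√-m)`, where `t⁴ = m`. -/
noncomputable def halfGen (t : ℂ) : ℂ := (1 + Complex.I * t ^ 2) / 2

lemma halfGen_sq {t : ℂ} {n : ℤ} (ht : t ^ 4 = 4 * n - 1) : halfGen t ^ 2 = halfGen t - n := by
  rw [halfGen]
  linear_combination (t ^ 4 / 4) * Complex.I_sq - ht / 4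

lemma sq_eq_halfGen (t : ℂ) : t ^ 2 = Complex.I - 2 * Complex.I * halfGen t := by
  rw [halfGen]
  linear_combination t ^ 2 * Complex.I_sq

lemma halfGen_I_mul (t : ℂ) : halfGen (Complex.I * t) = 1 - halfGen t := by
  rw [halfGen, halfGen]
  linear_combination (Complex.I * t ^ 2 / 2) * Complex.I_sq

lemma isIntegral_of_pow_four {t : ℂ} {n : ℤ} (ht : t ^ 4 = 4 * n - 1) : IsIntegral ℤ t :=
  IsIntegral.of_pow (n := 4) (by norm_num)
    ((isIntegral_intCast_complex (4 * n - 1)).of_eq (by rw [ht]; push_cast; ring))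

lemma isIntegral_halfGen {t : ℂ} {n : ℤ} (ht : t ^ 4 = 4 * n - 1) : IsIntegral ℤ (halfGen t) := by
  refine ⟨Polynomial.X ^ 2 - Polynomial.X + Polynomial.C n, by monicity!, ?_⟩
  rw [Polynomial.eval₂_add, Polynomial.eval₂_C]
  simp [halfGen_sq ht]

section Descent

variable {t p : ℂ} {n : ℤ}

lemma two_dvd_of_isIntegral_sq_pair (ht : t ^ 4 = 4 * n - 1) (hp : p * (1 + Complex.I) = 1)
    {a b : ℤ} (h1 : IsIntegral ℤ ((a + b * halfGen t) ^ 2 * p))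
    (h2 : IsIntegral ℤ ((a + b * (1 - halfGen t)) ^ 2 * p)) :
    (2 : ℤ) ∣ a ∧ (2 : ℤ) ∣ b := by
  have hI := Complex.isIntegral_I
  have hz := isIntegral_intCast_complex
  have hα := isIntegral_halfGen ht
  have hs := halfGen_sq ht
  have hp2 : p * 2 = 1 - Complex.I := by
    linear_combination (1 - Complex.I) * hp + p * Complex.I_sq
  have hb : (2 : ℤ) ∣ b := by
    refine two_dvd_of_isIntegral_sq_mul hp (((h1.add h2).sub
      ((hz (a ^ 2 + a * b - n * b ^ 2)).mul (isIntegral_one.sub hI))).of_eq ?_)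
    push_cast
    linear_combination (a ^ 2 + a * b - n * b ^ 2) * (-hp2) - (2 * b ^ 2 * p) * hs
  obtain ⟨c, rfl⟩ := hb
  refine ⟨two_dvd_of_isIntegral_sq_mul hp ((h1.sub ((((hz (2 * a * c)).mul hα).add
    (((hz (2 * c ^ 2)).mul (hα.pow 2)))).mul (isIntegral_one.sub hI))).of_eq ?_),
    dvd_mul_right _ _⟩
  push_cast
  linear_combination (-(2 * a * c * halfGen t + 2 * c ^ 2 * halfGen t ^ 2)) * hp2

lemma two_dvd_of_isIntegral_mul_one_add (ht : t ^ 4 = 4 * n - 1)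
    (hp : p * (1 + Complex.I) = 1) {a b : ℤ}
    (h1 : IsIntegral ℤ ((a + b * halfGen t) * (1 + t) * p))
    (h2 : IsIntegral ℤ ((a + b * (1 - halfGen t)) * (1 + Complex.I * t) * p)) :
    (2 : ℤ) ∣ a ∧ (2 : ℤ) ∣ b := by
  have hI := Complex.isIntegral_I
  have hz := isIntegral_intCast_complex
  have hα := isIntegral_halfGen ht
  have hti := isIntegral_of_pow_four ht
  have hq := sq_eq_halfGen t
  have hp2 := sq_mul_two_eq hp
  have hw := (hz a).add ((hz b).mul hα)
  have hw' := (hz a).add ((hz b).mul (isIntegral_one.sub hα))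
  have e1 : (1 + t) ^ 2 * p ^ 2 = p - halfGen t - Complex.I * t := by
    linear_combination p ^ 2 * hq + p * hp + (t - Complex.I * halfGen t) * hp2 +
      halfGen t * Complex.I_sq
  have e2 : (1 + Complex.I * t) ^ 2 * p ^ 2 = - Complex.I * p + halfGen t + t := by
    linear_combination (-p ^ 2) * hq - Complex.I * p * hp +
      Complex.I * (t + halfGen t) * hp2 + (p ^ 2 * t ^ 2 + p ^ 2 - t - halfGen t) * Complex.I_sq
  refine two_dvd_of_isIntegral_sq_pair ht hp
    (((h1.pow 2).add ((hw.pow 2).mul (hα.add (hI.mul hti)))).of_eq ?_)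
    ((((h2.pow 2).sub ((hw'.pow 2).mul (hα.add hti))).mul hI).of_eq ?_)
  · linear_combination (-(a + b * halfGen t) ^ 2) * e1
  · linear_combination (-(a + b * (1 - halfGen t)) ^ 2 * Complex.I) * e2 +
      ((a + b * (1 - halfGen t)) ^ 2 * p) * Complex.I_sq

lemma two_dvd_of_isIntegral_quad (ht : t ^ 4 = 4 * n - 1) (hp : p * (1 + Complex.I) = 1)
    {a b c d : ℤ} (h1 : IsIntegral ℤ ((a + b * halfGen t + (c + d * halfGen t) * t) * p))
    (h2 : IsIntegral ℤ
      ((a + b * (1 - halfGen t) + (c + d * (1 - halfGen t)) * (Complex.I * t)) * p)) :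
    ((2 : ℤ) ∣ a ∧ (2 : ℤ) ∣ b) ∧ (2 : ℤ) ∣ c ∧ (2 : ℤ) ∣ d := by
  have hI := Complex.isIntegral_I
  have hz := isIntegral_intCast_complex
  have hα := isIntegral_halfGen ht
  have hti := isIntegral_of_pow_four ht
  have hq := sq_eq_halfGen t
  have hp2 : p * 2 = 1 - Complex.I := by
    linear_combination (1 - Complex.I) * hp + p * Complex.I_sq
  have e1 : (t ^ 2 - 1) * p = Complex.I - halfGen t * (1 + Complex.I) := by
    linear_combination p * hq + Complex.I * hp - Complex.I * halfGen t * hp2 +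
      (-p + halfGen t) * Complex.I_sq
  have e2 : (1 + t ^ 2) * p = 1 - halfGen t * (1 + Complex.I) := by
    linear_combination p * hq + hp - Complex.I * halfGen t * hp2 + halfGen t * Complex.I_sq
  obtain ⟨hu, hv⟩ : (2 : ℤ) ∣ a + c ∧ (2 : ℤ) ∣ b + d := by
    refine two_dvd_of_isIntegral_mul_one_add ht hp
      (((h1.mul (isIntegral_one.add hti)).sub (((hz c).add ((hz d).mul hα)).mul
        (hI.sub (hα.mul (isIntegral_one.add hI))))).of_eq ?_)
      (((h2.mul (isIntegral_one.add (hI.mul hti))).add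
        (((hz c).add ((hz d).mul (isIntegral_one.sub hα))).mul
        (isIntegral_one.sub (hα.mul (isIntegral_one.add hI))))).of_eq ?_)
    · push_cast
      linear_combination (-(c + d * halfGen t)) * e1
    · push_cast
      linear_combination (c + d * (1 - halfGen t)) * e2 -
        (c + d * (1 - halfGen t)) * p * t ^ 2 * Complex.I_sq
  obtain ⟨k, hk⟩ : (2 : ℤ) ∣ a - c := by omega
  obtain ⟨l, hl⟩ : (2 : ℤ) ∣ b - d := by omega
  have hk' : (a : ℂ) = c + 2 * k := by exact_mod_cast (by omega : a = c + 2 * k)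
  have hl' : (b : ℂ) = d + 2 * l := by exact_mod_cast (by omega : b = d + 2 * l)
  have := two_dvd_of_isIntegral_mul_one_add ht hp (a := c) (b := d)
    ((h1.sub (((hz k).add ((hz l).mul hα)).mul (isIntegral_one.sub hI))).of_eq (by
      rw [hk', hl']
      linear_combination (-(k + l * halfGen t)) * hp2))
    ((h2.sub (((hz k).add ((hz l).mul (isIntegral_one.sub hα))).mul
      (isIntegral_one.sub hI))).of_eq (by
      rw [hk', hl']
      linear_combination (-(k + l * (1 - halfGen t))) * hp2))
  omega

end Descent

/-- The `8` products `jᵃ sᵇ`. -/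
def monomialFamily {F : Type*} [Field F] (j s : F) (q : Fin 2 × Fin 4) : F :=
  j ^ (q.1 : ℕ) * s ^ (q.2 : ℕ)

/-- The family `jᵃ ω sᵇ`, `jᵃ sᵇ` with `a, b ∈ {0, 1}`, where `ω = (1 + j s²) / 2`. -/
def integralFamily {F : Type*} [Field F] (j s : F) (q : Fin 2 × Fin 4) : F :=
  j ^ (q.1 : ℕ) * ![1, s, (1 + j * s ^ 2) / 2, (1 + j * s ^ 2) / 2 * s] q.2

lemma exists_integralFamily_of_one_add_mul {F : Type*} [Field F] {j s : F} {n : ℤ} {t : ℂ}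
    (ht : t ^ 4 = 4 * n - 1) (hj : j ^ 2 = -1) {φ ψ : F →+* ℂ} (hφj : φ j = Complex.I)
    (hφs : φ s = t) (hψj : ψ j = Complex.I) (hψs : ψ s = Complex.I * t) {x : F}
    (hx : IsIntegral ℤ x) {c : Fin 2 × Fin 4 → ℤ}
    (hc : (1 + j) * x = ∑ q, c q * integralFamily j s q) :
    ∃ d : Fin 2 × Fin 4 → ℤ, x = ∑ q, d q * integralFamily j s q := by
  have hp : (1 + Complex.I)⁻¹ * (1 + Complex.I) = 1 := by
    refine inv_mul_cancel₀ fun h => ?_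
    simpa using congrArg Complex.re h
  generalize (1 + Complex.I)⁻¹ = p at hp
  have hz := isIntegral_intCast_complex
  have hα := isIntegral_halfGen ht
  have hti := isIntegral_of_pow_four ht
  have hφα : φ ((1 + j * s ^ 2) / 2) = halfGen t := by simp [hφj, hφs, halfGen, map_ofNat φ 2]
  have hψα : ψ ((1 + j * s ^ 2) / 2) = 1 - halfGen t := by
    rw [← halfGen_I_mul]
    simp [hψj, hψs, halfGen, map_ofNat ψ 2]
  simp only [integralFamily] at hc ⊢
  generalize (1 + j * s ^ 2) / 2 = α at hc hφα hψα ⊢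
  simp only [Fintype.sum_prod_type, Fin.sum_univ_succ, Fin.sum_univ_zero] at hc ⊢
  simp at hc ⊢
  have hφ := congrArg φ hc
  have hψ := congrArg ψ hc
  simp [hφα, hφs, hφj] at hφ
  simp [hψα, hψs, hψj] at hψ
  obtain ⟨⟨⟨d0, h0⟩, d2, h2⟩, ⟨d1, h1⟩, d3, h3⟩ := two_dvd_of_isIntegral_quad ht hp
    (a := c (0, 0) - c (1, 0)) (b := c (0, 2) - c (1, 2)) (c := c (0, 1) - c (1, 1))
    (d := c (0, 3) - c (1, 3))
    (((map_isIntegral_int φ hx).sub (((hz (c (1, 0))).add ((hz (c (1, 2))).mul hα)).add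
      (((hz (c (1, 1))).add ((hz (c (1, 3))).mul hα)).mul hti))).of_eq (by
        push_cast
        linear_combination (-p) * hφ + (φ x - (c (1, 0) + c (1, 2) * halfGen t +
          (c (1, 1) + c (1, 3) * halfGen t) * t)) * hp))
    (((map_isIntegral_int ψ hx).sub (((hz (c (1, 0))).add ((hz (c (1, 2))).mul
      (isIntegral_one.sub hα))).add (((hz (c (1, 1))).add ((hz (c (1, 3))).mul
      (isIntegral_one.sub hα))).mul (Complex.isIntegral_I.mul hti)))).of_eq (by
        push_cast
        linear_combination (-p) * hψ + (ψ x - (c (1, 0) + c (1, 2) * (1 - halfGen t) +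
          (c (1, 1) + c (1, 3) * (1 - halfGen t)) * (Complex.I * t))) * hp))
  refine ⟨fun q => ![![c (1, 0) + d0, c (1, 1) + d1, c (1, 2) + d2, c (1, 3) + d3],
    ![-d0, -d1, -d2, -d3]] q.1 q.2, ?_⟩
  have h0 := congrArg (Int.cast (R := F)) h0
  have h1 := congrArg (Int.cast (R := F)) h1
  have h2 := congrArg (Int.cast (R := F)) h2
  have h3 := congrArg (Int.cast (R := F)) h3
  have hj1 : 1 + j ≠ 0 := by
    intro h
    have := congrArg Complex.re (congrArg φ h)
    simp [hφj] at this
  push_cast at h0 h1 h2 h3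
  refine mul_left_cancel₀ hj1 ?_
  simp [-mul_eq_mul_left_iff]
  linear_combination hc + h0 + s * h1 + α * h2 + α * s * h3 +
    (d0 + d1 * s + d2 * α + d3 * (α * s)) * hj

lemma exists_integralFamily_of_one_add_pow_mul {F : Type*} [Field F] {j s : F} {n : ℤ} {t : ℂ}
    (ht : t ^ 4 = 4 * n - 1) (hj : j ^ 2 = -1) {φ ψ : F →+* ℂ} (hφj : φ j = Complex.I)
    (hφs : φ s = t) (hψj : ψ j = Complex.I) (hψs : ψ s = Complex.I * t) {x : F}
    (hx : IsIntegral ℤ x) (e : ℕ) {c : Fin 2 × Fin 4 → ℤ}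
    (hc : (1 + j) ^ e * x = ∑ q, c q * integralFamily j s q) :
    ∃ d : Fin 2 × Fin 4 → ℤ, x = ∑ q, d q * integralFamily j s q := by
  have hji : IsIntegral ℤ (1 + j) :=
    isIntegral_one.add (IsIntegral.of_pow (n := 2) (by norm_num) (isIntegral_one.neg.of_eq hj))
  induction e generalizing c with
  | zero => exact ⟨c, by simpa using hc⟩
  | succ e ih =>
    rw [pow_succ', mul_assoc] at hc
    obtain ⟨d, hd⟩ := exists_integralFamily_of_one_add_mul ht hj hφj hφs hψj hψs
      ((hji.pow e).mul hx) hc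
    exact ih hd

lemma sum_neg_one_pow_mul_I (a b : Fin 2) :
    ∑ u : Fin 2, (-1 : ℂ) ^ (u * a : ℕ) * ((-1) ^ (u : ℕ) * Complex.I) ^ (b : ℕ) =
      if a = b then 2 * Complex.I ^ (a : ℕ) else 0 := by
  fin_cases a <;> fin_cases b <;> (norm_num [Fin.sum_univ_succ]; try ring)

lemma sum_I_pow_mul (t : ℂ) (a b : Fin 4) :
    ∑ v : Fin 4, Complex.I ^ (3 * v * a : ℕ) * (Complex.I ^ (v : ℕ) * t) ^ (b : ℕ) =
      if a = b then 4 * t ^ (a : ℕ) else 0 := by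
  have h4 := Complex.I_pow_four
  have hmod (e : ℕ) : Complex.I ^ e = Complex.I ^ (e % 4) := Complex.I_pow_eq_pow_mod e
  have h3 : Complex.I ^ 3 = -Complex.I := Complex.I_pow_three
  simp_rw [mul_pow, ← mul_assoc, ← pow_mul, ← pow_add]
  simp_rw [hmod (3 * _ * _ + _)]
  fin_cases a <;> fin_cases b <;> norm_num [Fin.sum_univ_succ, h3] <;> ring

lemma isInt_eight_mul_coeff {F : Type*} [Field F] [CharZero F] {m : ℕ} (hm : Squarefree m)
    {j s : F} {t : ℂ}
    (ht : t ^ 4 = m) (φ : Fin 2 × Fin 4 → F →+* ℂ)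
    (hφj : ∀ q, φ q j = (-1) ^ (q.1 : ℕ) * Complex.I)
    (hφs : ∀ q, φ q s = Complex.I ^ (q.2 : ℕ) * t)
    {a : Fin 2 × Fin 4 → ℚ} (hx : IsIntegral ℤ (∑ q, (a q : F) * monomialFamily j s q))
    (q : Fin 2 × Fin 4) : ∃ z : ℤ, 8 * a q = z := by
  have key : ∑ r : Fin 2 × Fin 4, ((-1 : ℂ) ^ (r.1 * q.1 : ℕ) * Complex.I ^ (3 * r.2 * q.2 : ℕ)) *
      φ r (∑ q, (a q : F) * monomialFamily j s q) =
      ((8 * a q : ℚ) : ℂ) * (Complex.I ^ (q.1 : ℕ) * t ^ (q.2 : ℕ)) := by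
    simp_rw [map_sum, Finset.mul_sum]
    rw [Finset.sum_comm]
    have (p : Fin 2 × Fin 4) : ∑ r : Fin 2 × Fin 4,
        ((-1 : ℂ) ^ (r.1 * q.1 : ℕ) * Complex.I ^ (3 * r.2 * q.2 : ℕ)) *
          φ r ((a p : F) * monomialFamily j s p) =
        a p * ((if q.1 = p.1 then 2 * Complex.I ^ (q.1 : ℕ) else 0) *
          (if q.2 = p.2 then 4 * t ^ (q.2 : ℕ) else 0)) := by
      rw [← sum_neg_one_pow_mul_I, ← sum_I_pow_mul, Finset.sum_mul_sum, Fintype.sum_prod_type,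
        Finset.mul_sum]
      refine Finset.sum_congr rfl fun u _ => ?_
      rw [Finset.mul_sum]
      refine Finset.sum_congr rfl fun v _ => ?_
      rw [monomialFamily, map_mul, map_mul, map_pow, map_pow, hφj, hφs, map_ratCast]
      ring
    simp_rw [this]
    rw [Finset.sum_eq_single q]
    · simp
      ring
    · intro p _ hpq
      have : q.1 ≠ p.1 ∨ q.2 ≠ p.2 := by
        by_contra! h
        exact hpq (Prod.ext h.1.symm h.2.symm)
      rcases this with h | h <;> simp [h]
    · simp
  have hint : IsIntegral ℤ (((8 * a q : ℚ) : ℂ) * (Complex.I ^ (q.1 : ℕ) * t ^ (q.2 : ℕ))) := by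
    rw [← key]
    refine IsIntegral.sum _ fun r _ => IsIntegral.mul (IsIntegral.mul ?_ ?_) ?_
    · exact isIntegral_one.neg.pow _
    · exact Complex.isIntegral_I.pow _
    · exact map_isIntegral_int (φ r) hx
  refine Rat.isInt_of_pow_four_mul hm q.2.isLt
    (isIntegral_complex_ratCast_iff.mp ((hint.pow 4).of_eq ?_))
  rw [mul_pow _ (_ * _), mul_pow (_ ^ _), ← pow_mul, ← pow_mul, mul_comm _ 4, mul_comm _ 4,
    pow_mul, pow_mul,
    Complex.I_pow_four, ht]
  push_cast
  ring

lemma exists_integralFamily_of_isIntegral {F : Type*} [Field F] [CharZero F] {m : ℕ}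
    (hm : Squarefree m) (h3 : m % 4 = 3) {j s : F} (hj : j ^ 2 = -1) {t : ℂ} (ht : t ^ 4 = m)
    (φ : Fin 2 × Fin 4 → F →+* ℂ) (hφj : ∀ q, φ q j = (-1) ^ (q.1 : ℕ) * Complex.I)
    (hφs : ∀ q, φ q s = Complex.I ^ (q.2 : ℕ) * t)
    {a : Fin 2 × Fin 4 → ℚ} (hx : IsIntegral ℤ (∑ q, (a q : F) * monomialFamily j s q)) :
    ∃ d : Fin 2 × Fin 4 → ℤ,
      ∑ q, (a q : F) * monomialFamily j s q = ∑ q, d q * integralFamily j s q := by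
  choose z hz using isInt_eight_mul_coeff hm ht φ hφj hφs hx
  have hz' (q) : 8 * (a q : F) = z q := by exact_mod_cast congrArg (Rat.cast (K := F)) (hz q)
  obtain ⟨n, hn⟩ : ∃ n : ℤ, (m : ℤ) = 4 * n - 1 := ⟨(m + 1) / 4, by omega⟩
  have htn : t ^ 4 = 4 * n - 1 := by rw [ht]; exact_mod_cast congrArg (Int.cast (R := ℂ)) hn
  refine exists_integralFamily_of_one_add_pow_mul (φ := φ (0, 0)) (ψ := φ (0, 1)) htn hj
    (by simp [hφj]) (by simp [hφs]) (by simp [hφj]) (by simp [hφs]) hx 6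
    (c := fun q => ![![z (1, 0) + z (0, 2), z (1, 1) + z (0, 3), -2 * z (0, 2), -2 * z (0, 3)],
      ![z (1, 2) - z (0, 0), z (1, 3) - z (0, 1), -2 * z (1, 2), -2 * z (1, 3)]] q.1 q.2) ?_
  have h6 : (1 + j) ^ 6 = -j * 8 := by
    have h2 : (1 + j) ^ 2 = 2 * j := by linear_combination hj
    linear_combination ((1 + j) ^ 4 + (1 + j) ^ 2 * (2 * j) + 4 * j ^ 2) * h2 + 8 * j * hj
  have h8 : (1 + j) ^ 6 * ∑ q, (a q : F) * monomialFamily j s q =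
      -j * ∑ q, (z q : F) * monomialFamily j s q := by
    rw [h6, mul_assoc, Finset.mul_sum]
    simp_rw [← mul_assoc, hz']
  rw [h8]
  simp only [monomialFamily, integralFamily]
  have hα : 2 * ((1 + j * s ^ 2) / 2) = 1 + j * s ^ 2 := mul_div_cancel₀ _ two_ne_zero
  generalize (1 + j * s ^ 2) / 2 = α at hα ⊢
  simp only [Fintype.sum_prod_type, Fin.sum_univ_succ, Fin.sum_univ_zero]
  simp
  linear_combination (z (0, 2) + s * z (0, 3) + j * z (1, 2) + j * s * z (1, 3)) * hα -
    (z (1, 0) + s * z (1, 1)) * hj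

open scoped Kronecker

/-- The change of basis from `monomialFamily` to `integralFamily`. -/
def indexMatrix : Matrix (Fin 2 × Fin 4) (Fin 2 × Fin 4) ℚ := fun p q =>
  ![![![![1, 0, 0, 0], ![0, 0, 0, 0]], ![![0, 1, 0, 0], ![0, 0, 0, 0]],
      ![![1 / 2, 0, 0, 0], ![0, 0, 1 / 2, 0]], ![![0, 1 / 2, 0, 0], ![0, 0, 0, 1 / 2]]],
    ![![![0, 0, 0, 0], ![1, 0, 0, 0]], ![![0, 0, 0, 0], ![0, 1, 0, 0]],
      ![![0, 0, -1 / 2, 0], ![1 / 2, 0, 0, 0]], ![![0, 0, 0, -1 / 2], ![0, 1 / 2, 0, 0]]]]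
    p.1 p.2 q.1 q.2

lemma indexMatrix_mul_transpose : indexMatrix * indexMatrix.transpose =
    (1 : Matrix (Fin 2) (Fin 2) ℚ) ⊗ₖ
      !![1, 0, 1 / 2, 0; 0, 1, 0, 1 / 2; 1 / 2, 0, 1 / 2, 0; 0, 1 / 2, 0, 1 / 2] := by
  ext ⟨a, b⟩ ⟨c, d⟩
  fin_cases a <;> fin_cases b <;> fin_cases c <;> fin_cases d <;>
    norm_num [indexMatrix, Matrix.mul_apply, Fintype.sum_prod_type, Fin.sum_univ_succ]

lemma det_indexMatrix_sq : indexMatrix.det ^ 2 = 1 / 256 := by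
  have h := congrArg Matrix.det indexMatrix_mul_transpose
  rw [Matrix.det_mul, Matrix.det_transpose, ← sq, Matrix.det_kronecker, Matrix.det_one, one_pow,
    one_mul] at h
  rw [h]
  simp [Matrix.det_succ_row_zero, Fin.sum_univ_succ, Fin.succAbove]
  norm_num

/-- The matrix of values `Tr(jᵃ sᵇ)` for `s⁴ = m`. -/
def monomialTraceMatrix (m : ℕ) : Matrix (Fin 2 × Fin 4) (Fin 2 × Fin 4) ℚ :=
  (!![2, 0; 0, -2] : Matrix (Fin 2) (Fin 2) ℚ) ⊗ₖ
    (!![4, 0, 0, 0; 0, 0, 0, 4 * m; 0, 0, 4 * m, 0; 0, 4 * m, 0, 0] : Matrix (Fin 4) (Fin 4) ℚ)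

lemma det_monomialTraceMatrix (m : ℕ) : (monomialTraceMatrix m).det = 2 ^ 24 * (m : ℚ) ^ 6 := by
  rw [monomialTraceMatrix, Matrix.det_kronecker]
  simp [Matrix.det_succ_row_zero, Fin.sum_univ_succ, Fin.succAbove]
  ring

lemma map_monomialFamily {F E : Type*} [Field F] [Field E] (φ : F →+* E) (j s : F)
    (q : Fin 2 × Fin 4) : φ (monomialFamily j s q) = monomialFamily (φ j) (φ s) q := by
  simp [monomialFamily]

lemma integralFamily_eq_mulVec {F : Type*} [Field F] [CharZero F] [Algebra ℚ F] {j s : F}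
    (hj : j ^ 2 = -1) : integralFamily j s =
      (indexMatrix.map (algebraMap ℚ F)).mulVec (monomialFamily j s) := by
  funext ⟨a, b⟩
  fin_cases a <;> fin_cases b <;>
    simp [integralFamily, monomialFamily, indexMatrix, Matrix.mulVec, dotProduct,
      Fintype.sum_prod_type, Fin.sum_univ_succ] <;>
    first | ring1 | linear_combination (s ^ 2 / 2) * hj | linear_combination (s ^ 3 / 2) * hj

lemma isIntegral_integralFamily {F : Type*} [Field F] [CharZero F] {j s : F} {n : ℤ}
    (hj : j ^ 2 = -1) (hs : s ^ 4 = 4 * n - 1) (q : Fin 2 × Fin 4) :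
    IsIntegral ℤ (integralFamily j s q) := by
  have hji : IsIntegral ℤ j :=
    IsIntegral.of_pow (n := 2) (by norm_num) (isIntegral_one.neg.of_eq hj)
  have hsi : IsIntegral ℤ s := IsIntegral.of_pow (n := 4) (by norm_num)
    ((isIntegral_algebraMap (R := ℤ) (A := F) (x := 4 * n - 1)).of_eq (by rw [hs]; simp))
  have hα : IsIntegral ℤ ((1 + j * s ^ 2) / 2) := by
    have h : ((1 + j * s ^ 2) / 2) ^ 2 = (1 + j * s ^ 2) / 2 - n := by
      linear_combination (s ^ 4 / 4) * hj - hs / 4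
    refine ⟨Polynomial.X ^ 2 - Polynomial.X + Polynomial.C n, by monicity!, ?_⟩
    rw [Polynomial.eval₂_add, Polynomial.eval₂_C]
    simp [h]
  refine (hji.pow _).mul ?_
  obtain ⟨a, b⟩ := q
  fin_cases b
  · exact isIntegral_one
  · exact hsi
  · exact hα
  · exact hα.mul hsi

/-- `i` as an element of `ℚ(i, m^(1/4))`. -/
noncomputable def genI (m : ℕ) : Kfield m :=
  ⟨Complex.I, IntermediateField.subset_adjoin _ _ (Set.mem_insert _ _)⟩

/-- `m^(1/4)` as an element of `ℚ(i, m^(1/4))`. -/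
noncomputable def genTheta (m : ℕ) : Kfield m :=
  ⟨theta m, IntermediateField.subset_adjoin _ _ (Set.mem_insert_of_mem _ rfl)⟩

lemma genI_sq (m : ℕ) : genI m ^ 2 = -1 :=
  Subtype.ext Complex.I_sq

lemma genTheta_pow_four (m : ℕ) : genTheta m ^ 4 = m :=
  Subtype.ext (theta_pow_four m)

lemma linearIndependent_monomialFamily {m : ℕ} (hm : Squarefree m) (h1 : m ≠ 1) :
    LinearIndependent ℚ (monomialFamily (genI m) (genTheta m)) := by
  rw [Fintype.linearIndependent_iff]
  intro a ha
  refine congrFun (coeff_eq_zero_of_I_theta hm h1 a ?_)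
  have := congrArg (algebraMap (Kfield m) ℂ) ha
  rw [map_sum, map_zero] at this
  rw [← this]
  refine Finset.sum_congr rfl fun p _ => ?_
  rw [Algebra.smul_def, map_mul, map_monomialFamily, ← IsScalarTower.algebraMap_apply]
  rfl

lemma algHom_ext_gen {m : ℕ} {φ ψ : Kfield m →ₐ[ℚ] ℂ} (hI : φ (genI m) = ψ (genI m))
    (hθ : φ (genTheta m) = ψ (genTheta m)) : φ = ψ := by
  refine IntermediateField.adjoin_algHom_ext ℚ ?_
  rintro x (rfl | rfl)
  · exact hI
  · exact hθ

lemma exists_eq_neg_one_pow_mul_I {z : ℂ} (hz : z ^ 2 = -1) :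
    ∃ a : Fin 2, z = (-1) ^ (a : ℕ) * Complex.I := by
  rcases sq_eq_sq_iff_eq_or_eq_neg.mp (hz.trans Complex.I_sq.symm) with h | h
  · exact ⟨0, by simp [h]⟩
  · exact ⟨1, by simp [h]⟩

lemma exists_eq_I_pow_mul {z t : ℂ} (hz : z ^ 4 = t ^ 4) :
    ∃ b : Fin 4, z = Complex.I ^ (b : ℕ) * t := by
  have h : (z - t) * (z + t) * ((z - Complex.I * t) * (z + Complex.I * t)) = 0 := by
    linear_combination hz + (-(z ^ 2 - t ^ 2) * t ^ 2) * Complex.I_sq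
  rcases mul_eq_zero.mp h with h | h <;> rcases mul_eq_zero.mp h with h | h
  · exact ⟨0, by simpa using sub_eq_zero.mp h⟩
  · exact ⟨2, by simpa using eq_neg_of_add_eq_zero_left h⟩
  · exact ⟨1, by simpa using sub_eq_zero.mp h⟩
  · exact ⟨3, by simpa [Complex.I_pow_three] using eq_neg_of_add_eq_zero_left h⟩

lemma exists_eq_sum_of_linearIndependent {K ι : Type*} [Field K] [CharZero K] [Fintype ι]
    [Nonempty ι] {v : ι → K} (hv : LinearIndependent ℚ v)
    (hcard : Fintype.card ι = Module.finrank ℚ K) (x : K) :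
    ∃ a : ι → ℚ, x = ∑ i, (a i : K) * v i := by
  let e := basisOfLinearIndependentOfCardEqFinrank hv hcard
  refine ⟨e.repr x, ?_⟩
  conv_lhs => rw [← e.sum_repr x]
  refine Finset.sum_congr rfl fun q _ => ?_
  rw [coe_basisOfLinearIndependentOfCardEqFinrank, Rat.smul_def]

section Embeddings

variable {m : ℕ} [NumberField (Kfield m)]

lemma finrank_Kfield_and_embeddings (hm : Squarefree m) (h1 : m ≠ 1) :
    Module.finrank ℚ (Kfield m) = 8 ∧
    ∃ Φ : Fin 2 × Fin 4 ≃ (Kfield m →ₐ[ℚ] ℂ),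
      (∀ q, Φ q (genI m) = (-1) ^ (q.1 : ℕ) * Complex.I) ∧
      ∀ q, Φ q (genTheta m) = Complex.I ^ (q.2 : ℕ) * theta m := by
  have hI (φ : Kfield m →ₐ[ℚ] ℂ) : ∃ a : Fin 2, φ (genI m) = (-1) ^ (a : ℕ) * Complex.I :=
    exists_eq_neg_one_pow_mul_I (by rw [← map_pow, genI_sq, map_neg, map_one])
  have hθ (φ : Kfield m →ₐ[ℚ] ℂ) :
      ∃ b : Fin 4, φ (genTheta m) = Complex.I ^ (b : ℕ) * theta m :=
    exists_eq_I_pow_mul (by rw [← map_pow, genTheta_pow_four, map_natCast, theta_pow_four])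
  choose f hf using hI
  choose g hg using hθ
  have hinj : Function.Injective fun φ => (f φ, g φ) := by
    intro φ ψ h
    obtain ⟨hfe, hge⟩ := Prod.mk.inj h
    exact algHom_ext_gen (by rw [hf, hf, hfe]) (by rw [hg, hg, hge])
  have hcard := AlgHom.card ℚ (Kfield m) ℂ
  have hle := Fintype.card_le_of_injective _ hinj
  have hge := (linearIndependent_monomialFamily hm h1).fintype_card_le_finrank
  simp only [Fintype.card_prod, Fintype.card_fin] at hle hge
  have hfin : Module.finrank ℚ (Kfield m) = 8 := by omega
  refine ⟨hfin, ?_⟩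
  have hbij := (Fintype.bijective_iff_injective_and_card _).mpr ⟨hinj, by
    rw [hcard, hfin]; rfl⟩
  let e := Equiv.ofBijective _ hbij
  refine ⟨e.symm, fun q => ?_, fun q => ?_⟩
  · rw [hf]
    exact congrArg (fun r : Fin 2 × Fin 4 => (-1 : ℂ) ^ (r.1 : ℕ) * Complex.I)
      (e.apply_symm_apply q)
  · rw [hg]
    exact congrArg (fun r : Fin 2 × Fin 4 => Complex.I ^ (r.2 : ℕ) * theta m)
      (e.apply_symm_apply q)

lemma traceMatrix_monomialFamily (hm : Squarefree m) (h1 : m ≠ 1) :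
    Algebra.traceMatrix ℚ (monomialFamily (genI m) (genTheta m)) = monomialTraceMatrix m := by
  obtain ⟨-, Φ, hI, hθ⟩ := finrank_Kfield_and_embeddings hm h1
  have hA (a c : Fin 2) : ∑ u : Fin 2, ((-1 : ℂ) ^ (u : ℕ) * Complex.I) ^ (a + c : ℕ) =
      ((!![2, 0; 0, -2] : Matrix (Fin 2) (Fin 2) ℚ) a c : ℂ) := by
    fin_cases a <;> fin_cases c <;> norm_num [Fin.sum_univ_succ]
  have hB (b d : Fin 4) : ∑ v : Fin 4, (Complex.I ^ (v : ℕ) * theta m) ^ (b + d : ℕ) =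
      ((!![4, 0, 0, 0; 0, 0, 0, 4 * m; 0, 0, 4 * m, 0; 0, 4 * m, 0, 0] :
        Matrix (Fin 4) (Fin 4) ℚ) b d : ℂ) := by
    simp_rw [mul_pow, ← pow_mul, Complex.I_pow_eq_pow_mod (_ * _)]
    have h4 := theta_pow_four m
    fin_cases b <;> fin_cases d <;>
      norm_num [Fin.sum_univ_succ, Complex.I_pow_three, h4]
  ext ⟨a, b⟩ ⟨c, d⟩
  rw [Algebra.traceMatrix_apply, Algebra.traceForm_apply]
  apply (algebraMap ℚ ℂ).injective
  rw [trace_eq_sum_embeddings, ← Φ.sum_comp, monomialTraceMatrix, Matrix.kroneckerMap_apply,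
    map_mul, eq_ratCast, eq_ratCast, ← hA, ← hB, Finset.sum_mul_sum, Fintype.sum_prod_type]
  refine Finset.sum_congr rfl fun u _ => Finset.sum_congr rfl fun v _ => ?_
  simp only [monomialFamily, map_mul, map_pow, hI, hθ]
  ring

lemma discr_integralFamily (hm : Squarefree m) (h1 : m ≠ 1) :
    Algebra.discr ℚ (integralFamily (genI m) (genTheta m)) = 2 ^ 16 * (m : ℚ) ^ 6 := by
  rw [integralFamily_eq_mulVec (genI_sq m), Algebra.discr_of_matrix_mulVec, det_indexMatrix_sq,
    Algebra.discr_def, traceMatrix_monomialFamily hm h1, det_monomialTraceMatrix]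
  ring

lemma exists_integralFamily_of_isIntegral_Kfield (hm : Squarefree m) (h3 : m % 4 = 3)
    (x : Kfield m) (hx : IsIntegral ℤ x) :
    ∃ d : Fin 2 × Fin 4 → ℤ, x = ∑ q, d q * integralFamily (genI m) (genTheta m) q := by
  have h1 : m ≠ 1 := by omega
  obtain ⟨hfin, Φ, hI, hθ⟩ := finrank_Kfield_and_embeddings hm h1
  obtain ⟨a, rfl⟩ := exists_eq_sum_of_linearIndependent
    (linearIndependent_monomialFamily hm h1) (by rw [hfin]; rfl) x
  exact exists_integralFamily_of_isIntegral hm h3 (genI_sq m) (theta_pow_four m)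
    (fun q => (Φ q).toRingHom) hI hθ hx

end Embeddings

/-- A family of integral elements with nonzero discriminant whose `ℤ`-span contains all integral
elements computes the discriminant of a number field. -/
lemma NumberField.discr_eq_discr_of_span {K ι : Type*} [Field K] [NumberField K] [Fintype ι]
    [DecidableEq ι] {v : ι → K} (hv : ∀ i, IsIntegral ℤ (v i)) (h0 : Algebra.discr ℚ v ≠ 0)
    (hspan : ∀ x : K, IsIntegral ℤ x → ∃ d : ι → ℤ, x = ∑ i, d i * v i) :
    (NumberField.discr K : ℚ) = Algebra.discr ℚ v := by
  let w (i : ι) : 𝓞 K := ⟨v i, hv i⟩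
  have hli : LinearIndependent ℤ w := by
    have hliQ : LinearIndependent ℚ v := by
      by_contra h
      exact h0 (Algebra.discr_zero_of_not_linearIndependent ℚ h)
    rw [Fintype.linearIndependent_iff] at hliQ ⊢
    intro g hg i
    have hsum := congrArg (algebraMap (𝓞 K) K) hg
    rw [map_sum, map_zero] at hsum
    have := hliQ (fun i => (g i : ℚ)) (by
      rw [← hsum]
      refine Finset.sum_congr rfl fun i _ => ?_
      rw [Int.cast_smul_eq_zsmul, map_zsmul]
      rfl) i
    exact_mod_cast this
  have htop : ⊤ ≤ Submodule.span ℤ (Set.range w) := by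
    rintro x -
    obtain ⟨d, hd⟩ := hspan x x.isIntegral_coe
    have hx : x = ∑ i, d i • w i := by
      apply RingOfIntegers.ext
      rw [hd]
      change _ = algebraMap (𝓞 K) K _
      rw [map_sum]
      refine Finset.sum_congr rfl fun i _ => ?_
      rw [map_zsmul, zsmul_eq_mul]
      rfl
    rw [hx]
    exact Submodule.sum_mem _ fun i _ => Submodule.smul_mem _ _ (Submodule.subset_span ⟨i, rfl⟩)
  rw [← NumberField.discr_eq_discr K (Module.Basis.mk hli htop), ← eq_intCast (algebraMap ℤ ℚ),
    ← Algebra.discr_localizationLocalization ℤ (nonZeroDivisors ℤ) K]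
  congr 1
  funext i
  rw [Module.Basis.localizationLocalization_apply, Module.Basis.mk_apply]
  rfl

/-- For squarefree `m ≡ 3 (mod 4)`, the discriminant of `ℚ(i, m^(1/4))` is `2^16 m^6`. -/
theorem stmt_5 (m : ℕ) (hm : Squarefree m) (hpos : 0 < m) (h3 : m % 4 = 3)
    [NumberField (Kfield m)] :
    NumberField.discr (Kfield m) = 2 ^ 16 * (m : ℤ) ^ 6 := by
  obtain ⟨n, hn⟩ : ∃ n : ℤ, (m : ℤ) = 4 * n - 1 := ⟨(m + 1) / 4, by omega⟩
  have hs : genTheta m ^ 4 = 4 * n - 1 := by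
    rw [genTheta_pow_four]
    exact_mod_cast congrArg (Int.cast (R := Kfield m)) hn
  have hdiscr := discr_integralFamily hm (by omega : m ≠ 1)
  have h0 : Algebra.discr ℚ (integralFamily (genI m) (genTheta m)) ≠ 0 := by
    rw [hdiscr]
    positivity
  have h := NumberField.discr_eq_discr_of_span (isIntegral_integralFamily (genI_sq m) hs) h0
    (exists_integralFamily_of_isIntegral_Kfield hm h3)
  rw [hdiscr] at h
  exact_mod_cast h
end
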